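/- arXiv:2405.17930 — 2 statements merged into one kernel-verified Lean document; each statement's English description precedes it below -/
import Mathlib

section
/- Let K be an algebraically closed field of characteristic zero, d ≥ 1, 1 ≤ r ≤ d, and let i_1,…,i_r be distinct indices in {1,…,d}. Let B = K⟨v1,…,vd⟩, let F = K⟨v1,…,vd,w1,…,wr⟩ be the free associative K-algebra on d+r generators, and let A be the quotient of F by the two-sided ideal generated by v_{i_α}w_α − 1 and w_α v_{i_α} − 1 for 1 ≤ α ≤ r, with quotient map π : F → A; write φ : B → A for the algebra homomorphism sending v_i to π(v_i). Suppose ⟪-,-⟫ is a mixed double Poisson algebra structure on B of weight (λ1,…,λd) ∈ K^d. Then there exists a unique K-linear map ⟪-,-⟫_A : A⊗A → A⊗A satisfying the Leibniz rules such that ⟪φ(v_i),φ(v_j)⟫_A = (φ⊗φ)(⟪v_i,v_j⟫) for all 1≤i,j≤d, and this map is a mixed double Poisson algebra structure on A of weight (λ1,…,λd,−λ_{i_1},…,−λ_{i_r}) with respect to the generators π(v1),…,π(vd),π(w1),…,π(wr) of A. -/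
open TensorProduct

noncomputable section

variable (K : Type*) [Field K]
variable (A : Type*) [Ring A] [Algebra K A]

/-- Leibniz rules for a double-bracket-type operation. -/
def LeibnizRules (D : A ⊗[K] A →ₗ[K] A ⊗[K] A) : Prop :=
  (∀ a b c : A,
      D (a ⊗ₜ[K] (b * c)) =
        (b ⊗ₜ[K] (1 : A)) * D (a ⊗ₜ[K] c) + D (a ⊗ₜ[K] b) * ((1 : A) ⊗ₜ[K] c))
  ∧ (∀ a b c : A,
      D ((a * b) ⊗ₜ[K] c) =
        ((1 : A) ⊗ₜ[K] a) * D (b ⊗ₜ[K] c) + D (a ⊗ₜ[K] c) * (b ⊗ₜ[K] (1 : A)))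

/-- The associated bracket `{a,b} = m(⟪a,b⟫)`. -/
def br (D : A ⊗[K] A →ₗ[K] A ⊗[K] A) (a b : A) : A :=
  LinearMap.mul' K A (D (a ⊗ₜ[K] b))

/-- The K-span of commutators `[A,A]`. -/
def commutatorSpan : Submodule K A :=
  Submodule.span K {x : A | ∃ a b : A, x = a * b - b * a}

/-- The flip on `A ⊗ A`. -/
def flipT : A ⊗[K] A →ₗ[K] A ⊗[K] A := (TensorProduct.comm K A A).toLinearMap

/-- Swap of the last two tensor factors of `(A ⊗ A) ⊗ A`. -/
def swap23 : ((A ⊗[K] A) ⊗[K] A) →ₗ[K] ((A ⊗[K] A) ⊗[K] A) :=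
  (TensorProduct.assoc K A A A).symm.toLinearMap ∘ₗ
    (LinearMap.lTensor A (TensorProduct.comm K A A).toLinearMap) ∘ₗ
    (TensorProduct.assoc K A A A).toLinearMap

/-- `⟪a, -⟫_L` on double tensors: `b ⊗ c ↦ ⟪a,b⟫ ⊗ c`. -/
def dL (D : A ⊗[K] A →ₗ[K] A ⊗[K] A) (a : A) :
    A ⊗[K] A →ₗ[K] (A ⊗[K] A) ⊗[K] A :=
  LinearMap.rTensor A (D ∘ₗ TensorProduct.mk K A A a)

/-- `⟪a, -⟫_R` on double tensors: `b ⊗ c ↦ b ⊗ ⟪a,c⟫`. -/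
def dR (D : A ⊗[K] A →ₗ[K] A ⊗[K] A) (a : A) :
    A ⊗[K] A →ₗ[K] (A ⊗[K] A) ⊗[K] A :=
  (TensorProduct.assoc K A A A).symm.toLinearMap ∘ₗ
    LinearMap.lTensor A (D ∘ₗ TensorProduct.mk K A A a)

/-- `⟪-, c⟫_L` on double tensors: `b ⊗ b' ↦ ⟪b,c⟫' ⊗ b' ⊗ ⟪b,c⟫''`. -/
def dLfst (D : A ⊗[K] A →ₗ[K] A ⊗[K] A) (c : A) :
    A ⊗[K] A →ₗ[K] (A ⊗[K] A) ⊗[K] A :=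
  swap23 K A ∘ₗ LinearMap.rTensor A (D ∘ₗ (TensorProduct.mk K A A).flip c)

/-- The double Jacobiator. -/
def DJac (D : A ⊗[K] A →ₗ[K] A ⊗[K] A) (a b c : A) : (A ⊗[K] A) ⊗[K] A :=
  dL K A D a (D (b ⊗ₜ[K] c)) - dR K A D b (D (a ⊗ₜ[K] c)) - dLfst K A D c (D (a ⊗ₜ[K] b))

/-- `c ⊗₁ (-)` : `w' ⊗ w'' ↦ w' ⊗ c ⊗ w''`. -/
def otimes1 (c : A) : A ⊗[K] A →ₗ[K] (A ⊗[K] A) ⊗[K] A :=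
  LinearMap.rTensor A ((TensorProduct.mk K A A).flip c)

variable {ι : Type*}

/-- Mixed double algebra structure of weight `lam` with respect to the generators `v`. -/
def IsMixedDouble (v : ι → A) (lam : ι → K) (D : A ⊗[K] A →ₗ[K] A ⊗[K] A) : Prop :=
  LeibnizRules K A D ∧
  ∀ i j : ι,
    D (v i ⊗ₜ[K] v j) + flipT K A (D (v j ⊗ₜ[K] v i)) =
      ((lam i + lam j) / 2) • (v i ⊗ₜ[K] v j - v j ⊗ₜ[K] v i) +
      ((lam i - lam j) / 2) • ((1 : A) ⊗ₜ[K] (v i * v j) - (v j * v i) ⊗ₜ[K] (1 : A))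

/-- Mixed double Poisson algebra structure of weight `lam` w.r.t. the generators `v`. -/
def IsMixedDoublePoisson (v : ι → A) (lam : ι → K) (D : A ⊗[K] A →ₗ[K] A ⊗[K] A) : Prop :=
  IsMixedDouble K A v lam D ∧
  ∀ i j k : ι,
    DJac K A D (v i) (v j) (v k) =
      (-((lam i + lam j) / 2)) • otimes1 K A (v j) (D (v i ⊗ₜ[K] v k)) +
      ((lam i - lam j) / 2) •
        otimes1 K A (1 : A) (((1 : A) ⊗ₜ[K] v j) * D (v i ⊗ₜ[K] v k))

/-- Modified double Poisson bracket. -/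
def IsModifiedDoublePoisson (D : A ⊗[K] A →ₗ[K] A ⊗[K] A) : Prop :=
  LeibnizRules K A D ∧
  (∀ a b : A, br K A D a b + br K A D b a ∈ commutatorSpan K A) ∧
  (∀ a b c : A,
    br K A D a (br K A D b c) - br K A D b (br K A D a c) - br K A D (br K A D a b) c = 0)

end


/-- The localisation relation: `v_{iα} w_α = 1 = w_α v_{iα}`. -/
def locRel (K : Type*) [Field K] (d r : ℕ) (idx : Fin r → Fin d) :
    FreeAlgebra K (Fin d ⊕ Fin r) → FreeAlgebra K (Fin d ⊕ Fin r) → Prop := fun x y =>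
  (∃ α : Fin r,
      x = FreeAlgebra.ι K (Sum.inl (idx α)) * FreeAlgebra.ι K (Sum.inr α) ∧ y = 1) ∨
  (∃ α : Fin r,
      x = FreeAlgebra.ι K (Sum.inr α) * FreeAlgebra.ι K (Sum.inl (idx α)) ∧ y = 1)

/-- The map `φ : K⟨v1,…,vd⟩ → A` sending `v_i` to `π(v_i)`. -/
noncomputable def locPhi (K : Type*) [Field K] (d r : ℕ) (idx : Fin r → Fin d) :
    FreeAlgebra K (Fin d) →ₐ[K] RingQuot (locRel K d r idx) :=
  FreeAlgebra.lift K
    (fun i => RingQuot.mkAlgHom K (locRel K d r idx) (FreeAlgebra.ι K (Sum.inl i)))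


set_option linter.unusedSectionVars false
set_option linter.unusedSimpArgs false

namespace MixedLoc

section gen
variable {K : Type*} [Field K] {A : Type*} [Ring A] [Algebra K A]

/-- first factor -/
noncomputable def e1 : A →ₐ[K] (A ⊗[K] A) ⊗[K] A :=
  (Algebra.TensorProduct.includeLeft (R := K) (S := K) (A := A ⊗[K] A) (B := A)).comp
    (Algebra.TensorProduct.includeLeft (R := K) (S := K) (A := A) (B := A))
/-- second factor -/
noncomputable def e2 : A →ₐ[K] (A ⊗[K] A) ⊗[K] A :=
  (Algebra.TensorProduct.includeLeft (R := K) (S := K) (A := A ⊗[K] A) (B := A)).comp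
    (Algebra.TensorProduct.includeRight (R := K) (A := A) (B := A))
/-- third factor -/
noncomputable def e3 : A →ₐ[K] (A ⊗[K] A) ⊗[K] A :=
  (Algebra.TensorProduct.includeRight (R := K) (A := A ⊗[K] A) (B := A))

theorem e1_apply (a : A) : e1 (K := K) a = (a ⊗ₜ 1) ⊗ₜ 1 := rfl
theorem e2_apply (a : A) : e2 (K := K) a = (1 ⊗ₜ a) ⊗ₜ 1 := rfl
theorem e3_apply (a : A) : e3 (K := K) a = 1 ⊗ₜ a := rfl

theorem c21 (a b : A) : e2 (K := K) b * e1 a = e1 a * e2 b := by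
  simp [e1_apply, e2_apply]
theorem c31 (a b : A) : e3 (K := K) b * e1 a = e1 a * e3 b := by
  simp [e1_apply, e3_apply]
theorem c32 (a b : A) : e3 (K := K) b * e2 a = e2 a * e3 b := by
  simp [e2_apply, e3_apply]

/-- factors 1,2 -/
noncomputable def e12 : A ⊗[K] A →ₐ[K] (A ⊗[K] A) ⊗[K] A :=
  Algebra.TensorProduct.lift e1 e2 (fun a b => (c21 a b).symm)
/-- factors 1,3 -/
noncomputable def e13 : A ⊗[K] A →ₐ[K] (A ⊗[K] A) ⊗[K] A :=
  Algebra.TensorProduct.lift e1 e3 (fun a b => (c31 a b).symm)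
/-- factors 2,3 -/
noncomputable def e23 : A ⊗[K] A →ₐ[K] (A ⊗[K] A) ⊗[K] A :=
  Algebra.TensorProduct.lift e2 e3 (fun a b => (c32 a b).symm)

theorem e12_tmul (a b : A) : e12 (a ⊗ₜ[K] b) = e1 a * e2 b := Algebra.TensorProduct.lift_tmul _ _ _ _ _
theorem e13_tmul (a b : A) : e13 (a ⊗ₜ[K] b) = e1 a * e3 b := Algebra.TensorProduct.lift_tmul _ _ _ _ _
theorem e23_tmul (a b : A) : e23 (a ⊗ₜ[K] b) = e2 a * e3 b := Algebra.TensorProduct.lift_tmul _ _ _ _ _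

theorem c3_12 (u : A ⊗[K] A) (a : A) : e3 a * e12 u = e12 u * e3 a := by
  induction u with
  | zero => simp
  | add x y hx hy => simp [mul_add, add_mul, hx, hy]
  | tmul x y => rw [e12_tmul, ← mul_assoc, c31, mul_assoc, c32, mul_assoc]
theorem c2_13 (u : A ⊗[K] A) (a : A) : e2 a * e13 u = e13 u * e2 a := by
  induction u with
  | zero => simp
  | add x y hx hy => simp [mul_add, add_mul, hx, hy]
  | tmul x y => rw [e13_tmul, ← mul_assoc, c21, mul_assoc, ← c32, mul_assoc]
theorem c1_23 (u : A ⊗[K] A) (a : A) : e1 a * e23 u = e23 u * e1 a := by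
  induction u with
  | zero => simp
  | add x y hx hy => simp [mul_add, add_mul, hx, hy]
  | tmul x y => rw [e23_tmul, ← mul_assoc, ← c21, mul_assoc, ← c31, mul_assoc]

variable (D : A ⊗[K] A →ₗ[K] A ⊗[K] A)

theorem e12_eq (u : A ⊗[K] A) : e12 u = u ⊗ₜ[K] (1 : A) := by
  induction u with
  | zero => simp
  | add x y hx hy => simp [add_tmul, hx, hy]
  | tmul x y => simp [e12_tmul, e1_apply, e2_apply]

theorem e23_eq (b : A) (u : A ⊗[K] A) :
    (TensorProduct.assoc K A A A).symm (b ⊗ₜ u) = e1 b * e23 u := by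
  induction u with
  | zero => simp
  | add x y hx hy => simp [tmul_add, mul_add, hx, hy]
  | tmul x y => simp [e23_tmul, e1_apply, e2_apply, e3_apply]

theorem swap_eq (b : A) (u : A ⊗[K] A) :
    swap23 K A (u ⊗ₜ b) = e13 u * e2 b := by
  induction u with
  | zero => simp
  | add x y hx hy => simp [add_tmul, add_mul, hx, hy]
  | tmul x y => simp [swap23, e13_tmul, e1_apply, e2_apply, e3_apply]

theorem dL_tmul (a x y : A) : dL K A D a (x ⊗ₜ y) = e12 (D (a ⊗ₜ x)) * e3 y := by
  simp [dL, e12_eq, e3_apply]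
theorem dR_tmul (a x y : A) : dR K A D a (x ⊗ₜ y) = e1 x * e23 (D (a ⊗ₜ y)) := by
  simp [dR, e23_eq]
theorem dLfst_tmul (c x y : A) : dLfst K A D c (x ⊗ₜ y) = e13 (D (x ⊗ₜ c)) * e2 y := by
  simp [dLfst, swap_eq]
theorem otimes1_eq (c : A) (u : A ⊗[K] A) : otimes1 K A c u = e13 u * e2 c := by
  induction u with
  | zero => simp
  | add x y hx hy => simp [add_mul, hx, hy]
  | tmul x y => simp [otimes1, e13_tmul, e1_apply, e2_apply, e3_apply]

variable {D} (hD : LeibnizRules K A D)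
include hD

theorem dL_1 (a c : A) (m : A ⊗[K] A) : dL K A D a ((c ⊗ₜ 1) * m) =
    e1 c * dL K A D a m + e12 (D (a ⊗ₜ c)) * e23 m := by
  induction m with
  | zero => simp
  | add x y hx hy => simp only [mul_add, map_add, hx, hy]; abel
  | tmul x y =>
    simp only [Algebra.TensorProduct.tmul_mul_tmul, one_mul, mul_one, dL_tmul, hD.1, map_add,
      map_mul, e12_tmul, e23_tmul, map_one, add_mul, mul_assoc]
theorem dL_2 (a c : A) (m : A ⊗[K] A) : dL K A D a (m * (1 ⊗ₜ c)) =
    dL K A D a m * e3 c := by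
  induction m with
  | zero => simp
  | add x y hx hy => simp only [add_mul, map_add, hx, hy]
  | tmul x y =>
    simp only [Algebra.TensorProduct.tmul_mul_tmul, one_mul, mul_one, dL_tmul, map_add,
      map_mul, mul_assoc]
theorem dL_3 (a c : A) (m : A ⊗[K] A) : dL K A D a ((1 ⊗ₜ c) * m) =
    e3 c * dL K A D a m := by
  induction m with
  | zero => simp
  | add x y hx hy => simp only [mul_add, map_add, hx, hy]
  | tmul x y =>
    simp only [Algebra.TensorProduct.tmul_mul_tmul, one_mul, mul_one, dL_tmul, map_add,
      map_mul]
    simp only [← mul_assoc, c3_12]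
theorem dL_4 (a c : A) (m : A ⊗[K] A) : dL K A D a (m * (c ⊗ₜ 1)) =
    e13 m * e12 (D (a ⊗ₜ c)) + dL K A D a m * e2 c := by
  induction m with
  | zero => simp
  | add x y hx hy => simp only [add_mul, map_add, hx, hy]; abel
  | tmul x y =>
    simp only [Algebra.TensorProduct.tmul_mul_tmul, one_mul, mul_one, dL_tmul, hD.1, map_add,
      map_mul, e12_tmul, e13_tmul, map_one, add_mul, mul_assoc, c32, c3_12]
theorem dL_5 (a b : A) (m : A ⊗[K] A) : dL K A D (a * b) m =
    e2 a * dL K A D b m + dL K A D a m * e1 b := by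
  induction m with
  | zero => simp
  | add x y hx hy => simp only [add_mul, mul_add, map_add, hx, hy]; abel
  | tmul x y =>
    simp only [dL_tmul, hD.2, map_add, map_mul, e12_tmul, map_one, add_mul, mul_assoc, c31,
      one_mul, mul_one]

theorem dR_1 (a c : A) (m : A ⊗[K] A) : dR K A D a ((c ⊗ₜ 1) * m) =
    e1 c * dR K A D a m := by
  induction m with
  | zero => simp
  | add x y hx hy => simp only [mul_add, map_add, hx, hy]
  | tmul x y =>
    simp only [Algebra.TensorProduct.tmul_mul_tmul, one_mul, mul_one, dR_tmul, map_add,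
      map_mul, mul_assoc]
theorem dR_2 (a c : A) (m : A ⊗[K] A) : dR K A D a (m * (1 ⊗ₜ c)) =
    e12 m * e23 (D (a ⊗ₜ c)) + dR K A D a m * e3 c := by
  induction m with
  | zero => simp
  | add x y hx hy => simp only [add_mul, map_add, hx, hy]; abel
  | tmul x y =>
    simp only [Algebra.TensorProduct.tmul_mul_tmul, one_mul, mul_one, dR_tmul, hD.1, map_add,
      map_mul, e12_tmul, e23_tmul, map_one, mul_add, mul_assoc]
theorem dR_3 (a c : A) (m : A ⊗[K] A) : dR K A D a ((1 ⊗ₜ c) * m) =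
    e2 c * dR K A D a m + e23 (D (a ⊗ₜ c)) * e13 m := by
  induction m with
  | zero => simp
  | add x y hx hy => simp only [mul_add, map_add, hx, hy]; abel
  | tmul x y =>
    simp only [Algebra.TensorProduct.tmul_mul_tmul, one_mul, mul_one, dR_tmul, hD.1, map_add,
      map_mul, e13_tmul, e23_tmul, map_one, mul_add]
    congr 1
    · rw [← mul_assoc, ← c21, mul_assoc]
    · rw [← mul_assoc, ← mul_assoc, c1_23]
theorem dR_4 (a c : A) (m : A ⊗[K] A) : dR K A D a (m * (c ⊗ₜ 1)) =
    dR K A D a m * e1 c := by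
  induction m with
  | zero => simp
  | add x y hx hy => simp only [add_mul, map_add, hx, hy]
  | tmul x y =>
    simp only [Algebra.TensorProduct.tmul_mul_tmul, one_mul, mul_one, dR_tmul, map_add,
      map_mul, mul_assoc]
    rw [c1_23]
theorem dR_5 (a b : A) (m : A ⊗[K] A) : dR K A D (a * b) m =
    e3 a * dR K A D b m + dR K A D a m * e2 b := by
  induction m with
  | zero => simp
  | add x y hx hy => simp only [add_mul, mul_add, map_add, hx, hy]; abel
  | tmul x y =>
    simp only [dR_tmul, hD.2, map_add, map_mul, e23_tmul, map_one, mul_add,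
      one_mul, mul_one]
    simp only [← mul_assoc, c31]

theorem dF_1 (a c : A) (m : A ⊗[K] A) : dLfst K A D a ((c ⊗ₜ 1) * m) =
    e3 c * dLfst K A D a m + e13 (D (c ⊗ₜ a)) * e12 m := by
  induction m with
  | zero => simp
  | add x y hx hy => simp only [mul_add, map_add, hx, hy]; abel
  | tmul x y =>
    simp only [Algebra.TensorProduct.tmul_mul_tmul, one_mul, mul_one, dLfst_tmul, hD.2, map_add,
      map_mul, e12_tmul, e13_tmul, map_one, add_mul, mul_assoc]
theorem dF_2 (a c : A) (m : A ⊗[K] A) : dLfst K A D a (m * (1 ⊗ₜ c)) =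
    dLfst K A D a m * e2 c := by
  induction m with
  | zero => simp
  | add x y hx hy => simp only [add_mul, map_add, hx, hy]
  | tmul x y =>
    simp only [Algebra.TensorProduct.tmul_mul_tmul, one_mul, mul_one, dLfst_tmul, map_add,
      map_mul, mul_assoc]
theorem dF_3 (a c : A) (m : A ⊗[K] A) : dLfst K A D a ((1 ⊗ₜ c) * m) =
    e2 c * dLfst K A D a m := by
  induction m with
  | zero => simp
  | add x y hx hy => simp only [mul_add, map_add, hx, hy]
  | tmul x y =>
    simp only [Algebra.TensorProduct.tmul_mul_tmul, one_mul, mul_one, dLfst_tmul, map_add,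
      map_mul]
    simp only [← mul_assoc, c2_13]
theorem dF_4 (a c : A) (m : A ⊗[K] A) : dLfst K A D a (m * (c ⊗ₜ 1)) =
    e23 (flipT K A m) * e13 (D (c ⊗ₜ a)) + dLfst K A D a m * e1 c := by
  induction m with
  | zero => simp
  | add x y hx hy => simp only [add_mul, map_add, hx, hy]; abel
  | tmul x y =>
    have : flipT K A (x ⊗ₜ y) = y ⊗ₜ x := by simp [flipT]
    rw [this]
    simp only [Algebra.TensorProduct.tmul_mul_tmul, one_mul, mul_one, dLfst_tmul, hD.2, map_add,
      map_mul, e13_tmul, e23_tmul, map_one, add_mul, mul_assoc, c21]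
    simp only [← mul_assoc, ← c32]
    simp only [mul_assoc, c2_13]
theorem dF_5 (a b : A) (m : A ⊗[K] A) : dLfst K A D (a * b) m =
    e1 a * dLfst K A D b m + dLfst K A D a m * e3 b := by
  induction m with
  | zero => simp
  | add x y hx hy => simp only [add_mul, mul_add, map_add, hx, hy]; abel
  | tmul x y =>
    simp only [dLfst_tmul, hD.1, map_add, map_mul, e13_tmul, map_one, add_mul, mul_assoc, c32,
      one_mul, mul_one]

theorem J_3 (a b c d : A) : DJac K A D a b (c * d) =
    e1 c * DJac K A D a b d + DJac K A D a b c * e3 d := by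
  simp only [DJac, hD.1, map_add, dL_1 hD, dL_2 hD, dR_1 hD, dR_2 hD, dF_5 hD]
  simp only [mul_add, add_mul, mul_sub, sub_mul, mul_assoc]
  abel
theorem J_2 (a b c d : A) : DJac K A D a (b * c) d =
    e3 b * DJac K A D a c d + DJac K A D a b d * e2 c := by
  simp only [DJac, hD.1, hD.2, map_add, dL_3 hD, dL_4 hD, dR_5 hD, dF_1 hD, dF_2 hD]
  simp only [mul_add, add_mul, mul_sub, sub_mul, mul_assoc]
  abel
theorem J_1 (a b c d : A) : DJac K A D (a * b) c d =
    e2 a * DJac K A D b c d + DJac K A D a c d * e1 b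
      - e23 (D (c ⊗ₜ a) + flipT K A (D (a ⊗ₜ c))) * e13 (D (b ⊗ₜ d)) := by
  simp only [DJac, hD.1, hD.2, map_add, dR_3 hD, dR_4 hD, dL_5 hD, dF_3 hD, dF_4 hD]
  simp only [mul_add, add_mul, mul_sub, sub_mul, mul_assoc]
  abel

omit hD

/-- skew-symmetry of weight -/
def Q (D : A ⊗[K] A →ₗ[K] A ⊗[K] A) (x : A) (l : K) (y : A) (m : K) : Prop :=
    D (x ⊗ₜ[K] y) + flipT K A (D (y ⊗ₜ[K] x)) =
      ((l + m) / 2) • (x ⊗ₜ[K] y - y ⊗ₜ[K] x) +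
      ((l - m) / 2) • ((1 : A) ⊗ₜ[K] (x * y) - (y * x) ⊗ₜ[K] (1 : A))

/-- Jacobi of weight -/
def J (D : A ⊗[K] A →ₗ[K] A ⊗[K] A) (x : A) (l : K) (y : A) (m : K) (z : A) : Prop :=
    DJac K A D x y z =
      (-((l + m) / 2)) • otimes1 K A y (D (x ⊗ₜ[K] z)) +
      ((l - m) / 2) •
        otimes1 K A (1 : A) (((1 : A) ⊗ₜ[K] y) * D (x ⊗ₜ[K] z))

theorem J_iff {x y z : A} {l m : K} : J D x l y m z ↔ DJac K A D x y z =
    (-((l + m) / 2)) • (e13 (D (x ⊗ₜ[K] z)) * e2 y) +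
      ((l - m) / 2) • (e3 y * e13 (D (x ⊗ₜ[K] z))) := by
  simp [J, otimes1_eq, e13_tmul]

theorem flip_mul (u v : A ⊗[K] A) : flipT K A (u * v) = flipT K A u * flipT K A v := 
  map_mul (Algebra.TensorProduct.comm K A A) u v

theorem flip_flip (u : A ⊗[K] A) : flipT K A (flipT K A u) = u := by
  simp [flipT]

theorem flip_tmul (x y : A) : flipT K A (x ⊗ₜ y) = y ⊗ₜ x := by
  simp [flipT]

theorem Q.symm {x y : A} {l m : K} (h : Q D x l y m) : Q D y m x l := by
  have := congrArg (flipT K A) h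
  simp only [map_add, map_sub, map_smul, flip_flip, flip_tmul] at this
  unfold Q
  rw [add_comm, this]
  module

include hD

theorem D_one_right (a : A) : D (a ⊗ₜ 1) = 0 := by
  have := hD.1 a 1 1
  simpa [← Algebra.TensorProduct.one_def] using this
theorem D_one_left (a : A) : D (1 ⊗ₜ a) = 0 := by
  have := hD.2 1 1 a
  simpa [← Algebra.TensorProduct.one_def] using this

theorem D_inv_right {y w : A} (h1 : y * w = 1) (h2 : w * y = 1) (a : A) :
    D (a ⊗ₜ w) = - ((w ⊗ₜ 1) * D (a ⊗ₜ y) * (1 ⊗ₜ w)) := by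
  have := hD.1 a y w
  rw [h1, D_one_right hD] at this
  have := congrArg (fun t => (w ⊗ₜ 1) * t) this
  simp only [mul_zero, mul_add, ← mul_assoc, Algebra.TensorProduct.tmul_mul_tmul, h2, mul_one,
    ← Algebra.TensorProduct.one_def, one_mul] at this
  rw [eq_neg_iff_add_eq_zero, ← this]

theorem D_inv_left {y w : A} (h1 : y * w = 1) (h2 : w * y = 1) (a : A) :
    D (w ⊗ₜ a) = - ((1 ⊗ₜ w) * D (y ⊗ₜ a) * (w ⊗ₜ 1)) := by
  have := hD.2 y w a
  rw [h1, D_one_left hD] at this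
  have := congrArg (fun t => (1 ⊗ₜ w) * t) this
  simp only [mul_zero, mul_add, ← mul_assoc, Algebra.TensorProduct.tmul_mul_tmul, h2, mul_one,
    ← Algebra.TensorProduct.one_def, one_mul] at this
  rw [eq_neg_iff_add_eq_zero, ← this]

theorem Q.inv_right {x y w : A} {l m : K} (h1 : y * w = 1) (h2 : w * y = 1)
    (h : Q D x l y m) : Q D x l w (-m) := by
  have key : D (x ⊗ₜ[K] w) + flipT K A (D (w ⊗ₜ[K] x)) =
      - ((w ⊗ₜ 1) * (D (x ⊗ₜ[K] y) + flipT K A (D (y ⊗ₜ[K] x))) * (1 ⊗ₜ w)) := by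
    rw [D_inv_right hD h1 h2, D_inv_left hD h1 h2]
    simp only [map_neg, flip_mul, flip_tmul]
    simp only [mul_add, add_mul, mul_assoc, neg_add]
  unfold Q
  rw [key, h]
  simp only [mul_add, add_mul, mul_sub, sub_mul, mul_smul_comm, smul_mul_assoc,
    Algebra.TensorProduct.tmul_mul_tmul, one_mul, mul_one, h1, h2, mul_assoc]
  simp only [← mul_assoc, h2, one_mul]
  module

theorem Q.inv_left {x y w : A} {l m : K} (h1 : y * w = 1) (h2 : w * y = 1)
    (h : Q D y m x l) : Q D w (-m) x l := 
  (Q.inv_right hD h1 h2 h.symm).symm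

theorem DJ_one_3 (a b : A) : DJac K A D a b 1 = 0 := by
  simpa using J_3 hD a b 1 1
theorem DJ_one_2 (a b : A) : DJac K A D a 1 b = 0 := by
  simpa using J_2 hD a 1 1 b
theorem DJ_one_1 (a b : A) : DJac K A D 1 a b = 0 := by
  simpa [D_one_left hD, D_one_right hD] using J_1 hD 1 1 a b

theorem e_inv (e : A →ₐ[K] (A ⊗[K] A) ⊗[K] A) {y w : A} (h : y * w = 1) : e y * e w = 1 := by
  rw [← map_mul, h, map_one]

omit hD in
theorem nm1 (a b : (A ⊗[K] A) ⊗[K] A) : -a * b = -(a * b) := by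
  rw [eq_neg_iff_add_eq_zero, ← add_mul, neg_add_cancel, zero_mul]
omit hD in
theorem nm2 (a b : (A ⊗[K] A) ⊗[K] A) : a * -b = -(a * b) := by
  rw [eq_neg_iff_add_eq_zero, ← mul_add, neg_add_cancel, mul_zero]

theorem J.inv3 {x y z w : A} {l m : K} (h1 : z * w = 1) (h2 : w * z = 1)
    (h : J D x l y m z) : J D x l y m w := by
  rw [J_iff] at *
  have k := J_3 hD x y z w
  rw [h1, DJ_one_3 hD, h] at k
  have k2 := congrArg (fun t => e1 w * t) k
  simp only [mul_zero, mul_add, ← mul_assoc, e_inv hD e1 h2, one_mul] at k2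
  rw [← sub_eq_zero, k2, D_inv_right hD h1 h2]
  simp only [map_neg, map_mul, e13_tmul, map_one, one_mul, mul_one, add_mul, mul_add,
    mul_smul_comm, smul_mul_assoc, nm2, nm1, ← mul_assoc, c31]
  simp only [mul_assoc, c32]
  module

theorem J.inv2 {x y z w : A} {l m : K} (h1 : y * w = 1) (h2 : w * y = 1)
    (h : J D x l y m z) : J D x l w (-m) z := by
  rw [J_iff] at *
  have k := J_2 hD x y w z
  rw [h1, DJ_one_2 hD, h] at k
  have k2 := congrArg (fun t => e3 w * t) k
  simp only [mul_zero, mul_add, ← mul_assoc, e_inv hD e3 h2, one_mul] at k2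
  rw [← sub_eq_zero, k2]
  simp only [add_mul, mul_add, mul_smul_comm, smul_mul_assoc, mul_assoc, e_inv hD e2 h1, mul_one]
  simp only [← mul_assoc, e_inv hD e3 h2, one_mul]
  module

theorem J.inv1 {x y z w : A} {l m : K} (h1 : x * w = 1) (h2 : w * x = 1)
    (hq : Q D y m x l)
    (h : J D x l y m z) : J D w (-l) y m z := by
  rw [J_iff] at *
  have k := J_1 hD x w y z
  have X : D (x ⊗ₜ z) = - ((1 ⊗ₜ x) * D (w ⊗ₜ z) * (x ⊗ₜ 1)) := D_inv_left hD h2 h1 z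
  rw [h1, DJ_one_1 hD, h, hq, X] at k
  generalize D (w ⊗ₜ z) = W at *
  have k2 := congrArg (fun t => e2 w * t) k
  simp only [mul_zero, mul_add, mul_sub, ← mul_assoc, e_inv hD e2 h2, one_mul] at k2
  rw [← sub_eq_zero, k2]
  simp only [map_neg, map_mul, map_add, map_sub, map_smul, e13_tmul, e23_tmul, map_one, one_mul,
    mul_one, add_mul, mul_add, sub_mul, mul_sub,
    mul_smul_comm, smul_mul_assoc, nm2, nm1]
  have a1 : e2 w * (e3 x * e13 W * e1 x * e2 y) * e1 w = e2 w * (e2 y * e3 x) * e13 W := by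
    rw [mul_assoc (e2 w), mul_assoc (e3 x * e13 W * e1 x), c21,
      ← mul_assoc (e3 x * e13 W * e1 x), mul_assoc (e3 x * e13 W) (e1 x), e_inv hD e1 h1, mul_one,
      mul_assoc (e3 x), ← c2_13, ← mul_assoc (e3 x), c32, mul_assoc (e2 w)]
  have a2 : e2 w * (e3 y * (e3 x * e13 W * e1 x)) * e1 w = e2 w * (e3 y * e3 x) * e13 W := by
    simp only [mul_assoc, e_inv hD e1 h1, mul_one]
  have a3 : e2 w * (e2 x * e3 y) * e13 W = e3 y * e13 W := by
    simp only [← mul_assoc, e_inv hD e2 h2, one_mul]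
  have a4 : e2 w * (e2 x * e2 y) * e13 W = e13 W * e2 y := by
    simp only [← mul_assoc, e_inv hD e2 h2, one_mul, c2_13]
  simp only [a1, a2, a3, a4]
  module

end gen

end MixedLoc

namespace MixedLoc

section der
variable {K : Type*} [Field K]

theorem free_ext {X : Type*} {R : Type*} [Ring R] [Algebra K R]
    (l ρ : FreeAlgebra K X →ₐ[K] R) (δ ε : FreeAlgebra K X →ₗ[K] R)
    (h : ∀ b c, δ (b * c) = l b * δ c + δ b * ρ c)
    (h' : ∀ b c, ε (b * c) = l b * ε c + ε b * ρ c)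
    (h0 : ∀ i, δ (FreeAlgebra.ι K i) = ε (FreeAlgebra.ι K i)) : δ = ε := by
  have o : δ 1 = 0 := by simpa using h 1 1
  have o' : ε 1 = 0 := by simpa using h' 1 1
  ext x
  induction x using FreeAlgebra.induction with
  | grade0 k => rw [Algebra.algebraMap_eq_smul_one, map_smul, map_smul, o, o']
  | grade1 i => exact h0 i
  | mul a b ha hb => rw [h, h', ha, hb]
  | add a b ha hb => rw [map_add, map_add, ha, hb]

variable {d r : ℕ} {idx : Fin r → Fin d}

/-- the quotient map -/
noncomputable abbrev q (K : Type*) [Field K] {d r : ℕ} (idx : Fin r → Fin d) :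
    FreeAlgebra K (Fin d ⊕ Fin r) →ₐ[K] RingQuot (locRel K d r idx) :=
  RingQuot.mkAlgHom K (locRel K d r idx)

/-- generators -/
noncomputable abbrev gv (K : Type*) [Field K] {d r : ℕ} (idx : Fin r → Fin d) (i : Fin d) :
    RingQuot (locRel K d r idx) := q K idx (FreeAlgebra.ι K (Sum.inl i))
/-- inverse generators -/
noncomputable abbrev gw (K : Type*) [Field K] {d r : ℕ} (idx : Fin r → Fin d) (i : Fin r) :
    RingQuot (locRel K d r idx) := q K idx (FreeAlgebra.ι K (Sum.inr i))

theorem vw (α : Fin r) : gv K idx (idx α) * gw K idx α = 1 := by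
  rw [← map_mul, ← map_one (q K idx)]
  exact RingQuot.mkAlgHom_rel K (Or.inl ⟨α, rfl, rfl⟩)
theorem wv (α : Fin r) : gw K idx α * gv K idx (idx α) = 1 := by
  rw [← map_mul, ← map_one (q K idx)]
  exact RingQuot.mkAlgHom_rel K (Or.inr ⟨α, rfl, rfl⟩)

variable {R : Type*} [Ring R] [Algebra K R]

theorem der_inv {A : Type*} [Ring A] [Algebra K A] (l ρ : A →ₐ[K] R) (δ : A →ₗ[K] R)
    (h : ∀ b c, δ (b * c) = l b * δ c + δ b * ρ c) {v w : A} (h1 : v * w = 1) (h2 : w * v = 1) :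
    δ w = - (l w * δ v * ρ w) := by
  have o : δ 1 = 0 := by simpa using h 1 1
  have k := h v w
  rw [h1, o] at k
  have k2 := congrArg (fun t => l w * t) k
  simp only [mul_zero, mul_add, ← mul_assoc, ← map_mul, h2, map_one, one_mul] at k2
  rw [eq_neg_iff_add_eq_zero, ← k2]

theorem der_ext (l ρ : RingQuot (locRel K d r idx) →ₐ[K] R)
    (δ ε : RingQuot (locRel K d r idx) →ₗ[K] R)
    (h : ∀ b c, δ (b * c) = l b * δ c + δ b * ρ c)
    (h' : ∀ b c, ε (b * c) = l b * ε c + ε b * ρ c)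
    (h0 : ∀ i, δ (gv K idx i) = ε (gv K idx i)) : δ = ε := by
  have : δ ∘ₗ (q K idx).toLinearMap = ε ∘ₗ (q K idx).toLinearMap := by
    apply free_ext (l.comp (q K idx)) (ρ.comp (q K idx))
    · intro b c; simp [h]
    · intro b c; simp [h']
    · rintro (i | α)
      · exact h0 i
      · change δ (gw K idx α) = ε (gw K idx α)
        rw [der_inv l ρ δ h (vw α) (wv α), der_inv l ρ ε h' (vw α) (wv α), h0]
  ext x
  obtain ⟨x, rfl⟩ := RingQuot.mkAlgHom_surjective K (locRel K d r idx) x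
  exact LinearMap.congr_fun this x

theorem der_exists (l ρ : RingQuot (locRel K d r idx) →ₐ[K] R) (f : Fin d → R) :
    ∃ δ : RingQuot (locRel K d r idx) →ₗ[K] R,
      (∀ b c, δ (b * c) = l b * δ c + δ b * ρ c) ∧ ∀ i, δ (gv K idx i) = f i := by
  let g : Fin d ⊕ Fin r → Matrix (Fin 2) (Fin 2) R :=
    Sum.elim (fun i => !![l (gv K idx i), f i; 0, ρ (gv K idx i)])
      (fun α => !![l (gw K idx α), -(l (gw K idx α) * f (idx α) * ρ (gw K idx α));
        0, ρ (gw K idx α)])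
  have e1 : ∀ (e : RingQuot (locRel K d r idx) →ₐ[K] R) α,
      e (gv K idx (idx α)) * e (gw K idx α) = 1 := fun e α => by rw [← map_mul, vw, map_one]
  have e2 : ∀ (e : RingQuot (locRel K d r idx) →ₐ[K] R) α,
      e (gw K idx α) * e (gv K idx (idx α)) = 1 := fun e α => by rw [← map_mul, wv, map_one]
  have hg : ∀ x y, locRel K d r idx x y → FreeAlgebra.lift K g x = FreeAlgebra.lift K g y := by
    rintro x y (⟨α, rfl, rfl⟩ | ⟨α, rfl, rfl⟩)
    · simp only [map_mul, map_one, FreeAlgebra.lift_ι_apply, g, Sum.elim_inl, Sum.elim_inr]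
      rw [Matrix.mul_fin_two, Matrix.one_fin_two]
      simp [e1, ← mul_assoc]
    · simp only [map_mul, map_one, FreeAlgebra.lift_ι_apply, g, Sum.elim_inl, Sum.elim_inr]
      rw [Matrix.mul_fin_two, Matrix.one_fin_two]
      simp [e2, mul_assoc]
  let H : RingQuot (locRel K d r idx) →ₐ[K] Matrix (Fin 2) (Fin 2) R :=
    RingQuot.liftAlgHom K ⟨FreeAlgebra.lift K g, hg⟩
  have Hq : ∀ x, H (q K idx x) = FreeAlgebra.lift K g x := fun x =>
    RingQuot.liftAlgHom_mkAlgHom_apply K _ _ _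
  have key : ∀ a, H a 0 0 = l a ∧ H a 1 1 = ρ a ∧ H a 1 0 = 0 := by
    intro a
    obtain ⟨a, rfl⟩ := RingQuot.mkAlgHom_surjective K (locRel K d r idx) a
    rw [Hq]
    induction a using FreeAlgebra.induction with
    | grade0 k => simp [Matrix.algebraMap_matrix_apply]
    | grade1 i => rcases i with i | α <;> simp [g, FreeAlgebra.lift_ι_apply]
    | mul a b ha hb =>
      simp [Matrix.mul_apply, Fin.sum_univ_two, ha.1, ha.2.1, ha.2.2, hb.1, hb.2.1, hb.2.2]
    | add a b ha hb => simp [ha.1, ha.2.1, ha.2.2, hb.1, hb.2.1, hb.2.2]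
  refine ⟨⟨⟨fun a => H a 0 1, ?_⟩, ?_⟩, ?_, ?_⟩
  · intro a b; simp
  · intro k a; simp
  · intro b c
    simp [Matrix.mul_apply, Fin.sum_univ_two, (key b).1, (key c).2.1]
  · intro i
    change H (gv K idx i) 0 1 = f i
    rw [Hq]
    simp [g]

end der

section main
variable {K : Type*} [Field K] {d r : ℕ} {idx : Fin r → Fin d}

local notation "AA" => RingQuot (locRel K d r idx)

/-- left inclusion -/
noncomputable abbrev iL (K A : Type*) [Field K] [Ring A] [Algebra K A] : A →ₐ[K] A ⊗[K] A :=
  Algebra.TensorProduct.includeLeft (R := K) (S := K) (A := A) (B := A)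
/-- right inclusion -/
noncomputable abbrev iR (K A : Type*) [Field K] [Ring A] [Algebra K A] : A →ₐ[K] A ⊗[K] A :=
  Algebra.TensorProduct.includeRight (R := K) (A := A) (B := A)

/-- constant-family map -/
noncomputable abbrev cst (ι K R A : Type*) [Field K] [Ring R] [Algebra K R] [Ring A] [Algebra K A]
    (l : A →ₐ[K] R) : A →ₐ[K] (ι → R) := AlgHom.pi (fun _ => l)

theorem exists_D (f : Fin d → Fin d → AA ⊗[K] AA) :
    ∃ DA : AA ⊗[K] AA →ₗ[K] AA ⊗[K] AA, LeibnizRules K AA DA ∧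
      ∀ i j, DA (gv K idx i ⊗ₜ gv K idx j) = f i j := by
  have hex := fun g => der_exists (idx := idx) (iL K AA) (iR K AA) g
  choose δ hδ hδ' using hex
  have hu : ∀ g (ε : AA →ₗ[K] AA ⊗[K] AA),
      (∀ b c, ε (b * c) = iL K AA b * ε c + ε b * iR K AA c) →
      (∀ i, ε (gv K idx i) = g i) → δ g = ε := fun g ε h1 h2 =>
    der_ext _ _ _ _ (hδ g) h1 (fun i => (hδ' g i).trans (h2 i).symm)
  let Δ : (Fin d → AA ⊗[K] AA) →ₗ[K] (AA →ₗ[K] AA ⊗[K] AA) :=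
    { toFun := δ
      map_add' := fun g h => hu _ _ (fun b c => by
          simp only [LinearMap.add_apply, hδ, mul_add, add_mul]; abel)
        (fun i => by simp only [LinearMap.add_apply, hδ', Pi.add_apply])
      map_smul' := fun k g => hu _ _ (fun b c => by
          simp only [LinearMap.smul_apply, hδ, smul_add, RingHom.id_apply, mul_smul_comm,
            smul_mul_assoc])
        (fun i => by simp only [LinearMap.smul_apply, hδ', Pi.smul_apply, RingHom.id_apply]) }
  obtain ⟨F, hF, hF'⟩ := der_exists (idx := idx) (cst (Fin d) K _ _ (iR K AA))
    (cst (Fin d) K _ _ (iL K AA)) f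
  refine ⟨TensorProduct.lift (Δ ∘ₗ F), ⟨?_, ?_⟩, ?_⟩
  · intro a b c
    exact hδ (F a) b c
  · intro a b c
    have : δ (F (a * b)) = LinearMap.mulLeft K (iR K AA a) ∘ₗ δ (F b) +
        LinearMap.mulRight K (iL K AA b) ∘ₗ δ (F a) := by
      apply hu
      · intro x y
        simp only [LinearMap.add_apply, LinearMap.comp_apply, LinearMap.mulLeft_apply,
          LinearMap.mulRight_apply, hδ, mul_add, add_mul]
        have c1 : iR K AA a * iL K AA x = iL K AA x * iR K AA a := by simp
        have c2 : iL K AA b * iR K AA y = iR K AA y * iL K AA b := by simp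
        simp only [mul_assoc, c2]
        simp only [← mul_assoc, c1]
        abel
      · intro i
        simp [hF, hδ']
    exact LinearMap.congr_fun this c
  · intro i j
    change δ (F (gv K idx i)) (gv K idx j) = _
    rw [hδ', hF']

theorem unique_D (D E : AA ⊗[K] AA →ₗ[K] AA ⊗[K] AA) (hD : LeibnizRules K AA D)
    (hE : LeibnizRules K AA E)
    (h : ∀ i j, D (gv K idx i ⊗ₜ gv K idx j) = E (gv K idx i ⊗ₜ gv K idx j)) : D = E := by
  have s1 : ∀ i, D ∘ₗ TensorProduct.mk K AA AA (gv K idx i) =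
      E ∘ₗ TensorProduct.mk K AA AA (gv K idx i) := fun i =>
    der_ext (iL K AA) (iR K AA) _ _ (fun b c => hD.1 _ b c) (fun b c => hE.1 _ b c) (h i)
  have s2 : ∀ c, D ∘ₗ (TensorProduct.mk K AA AA).flip c =
      E ∘ₗ (TensorProduct.mk K AA AA).flip c := fun c =>
    der_ext (iR K AA) (iL K AA) _ _ (fun a b => hD.2 a b c) (fun a b => hE.2 a b c)
      (fun i => LinearMap.congr_fun (s1 i) c)
  ext a b
  exact LinearMap.congr_fun (s2 b) a

end main

section transport
variable {K : Type*} [Field K] {X : Type*} {A : Type*} [Ring A] [Algebra K A]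
  (φ : FreeAlgebra K X →ₐ[K] A)

theorem transport_D (D : FreeAlgebra K X ⊗[K] FreeAlgebra K X →ₗ[K]
      FreeAlgebra K X ⊗[K] FreeAlgebra K X) (E : A ⊗[K] A →ₗ[K] A ⊗[K] A)
    (hD : LeibnizRules K _ D) (hE : LeibnizRules K A E)
    (h : ∀ i j, E (φ (FreeAlgebra.ι K i) ⊗ₜ φ (FreeAlgebra.ι K j)) =
      Algebra.TensorProduct.map φ φ (D (FreeAlgebra.ι K i ⊗ₜ FreeAlgebra.ι K j)))
    (a b : FreeAlgebra K X) :
    E (φ a ⊗ₜ φ b) = Algebra.TensorProduct.map φ φ (D (a ⊗ₜ b)) := by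
  have s1 : ∀ i, (E ∘ₗ TensorProduct.mk K A A (φ (FreeAlgebra.ι K i))) ∘ₗ φ.toLinearMap =
      (Algebra.TensorProduct.map φ φ).toLinearMap ∘ₗ D ∘ₗ TensorProduct.mk K _ _
        (FreeAlgebra.ι K i) := fun i =>
    free_ext ((iL K A).comp φ) ((iR K A).comp φ) _ _ (fun b c => by simp [hE.1])
      (fun b c => by
        simp only [LinearMap.comp_apply, TensorProduct.mk_apply, LinearMap.flip_apply,
          AlgHom.toLinearMap_apply, hD.1, map_add, map_mul, Algebra.TensorProduct.map_tmul, map_one]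
        rfl) (h i)
  have s2 : ∀ c, (E ∘ₗ (TensorProduct.mk K A A).flip (φ c)) ∘ₗ φ.toLinearMap =
      (Algebra.TensorProduct.map φ φ).toLinearMap ∘ₗ D ∘ₗ (TensorProduct.mk K _ _).flip
        c := fun c =>
    free_ext ((iR K A).comp φ) ((iL K A).comp φ) _ _ (fun b c => by simp [hE.2])
      (fun b c => by
        simp only [LinearMap.comp_apply, TensorProduct.mk_apply, LinearMap.flip_apply,
          AlgHom.toLinearMap_apply, hD.2, map_add, map_mul, Algebra.TensorProduct.map_tmul, map_one]
        rfl) (fun i => LinearMap.congr_fun (s1 i) c)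
  exact LinearMap.congr_fun (s2 b) a

variable {B : Type*} [Ring B] [Algebra K B] (ψ : B →ₐ[K] A)
  (D : B ⊗[K] B →ₗ[K] B ⊗[K] B) (E : A ⊗[K] A →ₗ[K] A ⊗[K] A)

/-- map on double tensors -/
noncomputable abbrev m2 : B ⊗[K] B →ₐ[K] A ⊗[K] A := Algebra.TensorProduct.map ψ ψ
/-- map on triple tensors -/
noncomputable abbrev m3 : (B ⊗[K] B) ⊗[K] B →ₐ[K] (A ⊗[K] A) ⊗[K] A :=
  Algebra.TensorProduct.map (m2 ψ) ψ

theorem m3_e1 (x : B) : m3 ψ (e1 x) = e1 (ψ x) := by simp [e1_apply]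
theorem m3_e2 (x : B) : m3 ψ (e2 x) = e2 (ψ x) := by simp [e2_apply]
theorem m3_e3 (x : B) : m3 ψ (e3 x) = e3 (ψ x) := by simp [e3_apply]
theorem m3_e12 (u : B ⊗[K] B) : m3 ψ (e12 u) = e12 (m2 ψ u) := by
  induction u with
  | zero => simp
  | add x y hx hy => rw [map_add, map_add, map_add, map_add, hx, hy]
  | tmul x y => rw [e12_tmul, map_mul, m3_e1, m3_e2, Algebra.TensorProduct.map_tmul, e12_tmul]
theorem m3_e13 (u : B ⊗[K] B) : m3 ψ (e13 u) = e13 (m2 ψ u) := by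
  induction u with
  | zero => simp
  | add x y hx hy => rw [map_add, map_add, map_add, map_add, hx, hy]
  | tmul x y => rw [e13_tmul, map_mul, m3_e1, m3_e3, Algebra.TensorProduct.map_tmul, e13_tmul]
theorem m3_e23 (u : B ⊗[K] B) : m3 ψ (e23 u) = e23 (m2 ψ u) := by
  induction u with
  | zero => simp
  | add x y hx hy => rw [map_add, map_add, map_add, map_add, hx, hy]
  | tmul x y => rw [e23_tmul, map_mul, m3_e2, m3_e3, Algebra.TensorProduct.map_tmul, e23_tmul]

variable {D E} (h : ∀ a b, E (ψ a ⊗ₜ ψ b) = m2 ψ (D (a ⊗ₜ b)))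
include h

theorem t_dL (a : B) (u : B ⊗[K] B) : dL K A E (ψ a) (m2 ψ u) = m3 ψ (dL K B D a u) := by
  induction u with
  | zero => simp
  | add x y hx hy => rw [map_add, map_add, map_add, map_add, hx, hy]
  | tmul x y =>
    rw [Algebra.TensorProduct.map_tmul, dL_tmul, dL_tmul, map_mul, m3_e12, m3_e3, h]
theorem t_dR (a : B) (u : B ⊗[K] B) : dR K A E (ψ a) (m2 ψ u) = m3 ψ (dR K B D a u) := by
  induction u with
  | zero => simp
  | add x y hx hy => rw [map_add, map_add, map_add, map_add, hx, hy]
  | tmul x y =>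
    rw [Algebra.TensorProduct.map_tmul, dR_tmul, dR_tmul, map_mul, m3_e23, m3_e1, h]
theorem t_dF (a : B) (u : B ⊗[K] B) : dLfst K A E (ψ a) (m2 ψ u) = m3 ψ (dLfst K B D a u) := by
  induction u with
  | zero => simp
  | add x y hx hy => rw [map_add, map_add, map_add, map_add, hx, hy]
  | tmul x y =>
    rw [Algebra.TensorProduct.map_tmul, dLfst_tmul, dLfst_tmul, map_mul, m3_e13, m3_e2, h]

theorem t_J {x y z : B} {l m : K} (hJ : J D x l y m z) : J E (ψ x) l (ψ y) m (ψ z) := by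
  rw [J_iff] at *
  have : DJac K A E (ψ x) (ψ y) (ψ z) = m3 ψ (DJac K B D x y z) := by
    simp only [DJac, h, t_dL ψ h, t_dR ψ h, t_dF ψ h, map_sub]
  rw [this, hJ]
  simp only [map_add, map_smul, map_mul, m3_e13, m3_e2, m3_e3, h]

theorem t_Q {x y : B} {l m : K} (hQ : Q D x l y m) : Q E (ψ x) l (ψ y) m := by
  have f : ∀ u, flipT K A (m2 ψ u) = m2 ψ (flipT K B u) := by
    intro u
    induction u with
    | zero => simp
    | add x y hx hy => rw [map_add, map_add, map_add, map_add, hx, hy]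
    | tmul x y => simp [flipT]
  have := congrArg (m2 ψ) hQ
  simp only [map_add, map_sub, map_smul, ← h, ← f, Algebra.TensorProduct.map_tmul, map_mul,
    map_one] at this
  exact this

end transport

end MixedLoc

theorem stmt9 {K : Type*} [Field K] [IsAlgClosed K] [CharZero K]
    {d r : ℕ} (hd : 1 ≤ d) (hr : 1 ≤ r) (hrd : r ≤ d)
    (idx : Fin r → Fin d) (hidx : Function.Injective idx)
    (lam : Fin d → K)
    (D : FreeAlgebra K (Fin d) ⊗[K] FreeAlgebra K (Fin d) →ₗ[K]
         FreeAlgebra K (Fin d) ⊗[K] FreeAlgebra K (Fin d))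
    (hD : IsMixedDoublePoisson K (FreeAlgebra K (Fin d)) (FreeAlgebra.ι K) lam D) :
    (∃! DA : RingQuot (locRel K d r idx) ⊗[K] RingQuot (locRel K d r idx) →ₗ[K]
             RingQuot (locRel K d r idx) ⊗[K] RingQuot (locRel K d r idx),
        LeibnizRules K (RingQuot (locRel K d r idx)) DA ∧
        ∀ i j : Fin d,
          DA (locPhi K d r idx (FreeAlgebra.ι K i) ⊗ₜ[K] locPhi K d r idx (FreeAlgebra.ι K j)) =
            TensorProduct.map (locPhi K d r idx).toLinearMap (locPhi K d r idx).toLinearMap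
              (D (FreeAlgebra.ι K i ⊗ₜ[K] FreeAlgebra.ι K j))) ∧
    (∀ DA : RingQuot (locRel K d r idx) ⊗[K] RingQuot (locRel K d r idx) →ₗ[K]
            RingQuot (locRel K d r idx) ⊗[K] RingQuot (locRel K d r idx),
        (LeibnizRules K (RingQuot (locRel K d r idx)) DA ∧
          ∀ i j : Fin d,
            DA (locPhi K d r idx (FreeAlgebra.ι K i) ⊗ₜ[K] locPhi K d r idx (FreeAlgebra.ι K j)) =
              TensorProduct.map (locPhi K d r idx).toLinearMap (locPhi K d r idx).toLinearMap
                (D (FreeAlgebra.ι K i ⊗ₜ[K] FreeAlgebra.ι K j))) →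
        IsMixedDoublePoisson K (RingQuot (locRel K d r idx))
          (fun s : Fin d ⊕ Fin r => RingQuot.mkAlgHom K (locRel K d r idx) (FreeAlgebra.ι K s))
          (Sum.elim lam (fun α : Fin r => - lam (idx α))) DA) := by
  have hphi : ∀ i, locPhi K d r idx (FreeAlgebra.ι K i) = MixedLoc.gv K idx i := fun i => by
    simp [locPhi]
  have hmap : ∀ u, TensorProduct.map (locPhi K d r idx).toLinearMap (locPhi K d r idx).toLinearMap
      u = MixedLoc.m2 (locPhi K d r idx) u := fun u => rfl
  refine ⟨?_, ?_⟩
  · obtain ⟨DA, h1, h2⟩ := MixedLoc.exists_D (K := K) (idx := idx) (fun i j =>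
      TensorProduct.map (locPhi K d r idx).toLinearMap (locPhi K d r idx).toLinearMap
              (D (FreeAlgebra.ι K i ⊗ₜ[K] FreeAlgebra.ι K j)))
    refine ⟨DA, ⟨h1, fun i j => ?_⟩, fun E hE => ?_⟩
    · rw [hphi, hphi, h2]
    · refine MixedLoc.unique_D _ _ hE.1 h1 (fun i j => ?_)
      rw [h2, ← hE.2, hphi, hphi]
  · rintro E ⟨hE, hE2⟩
    have h := MixedLoc.transport_D (locPhi K d r idx) D E hD.1.1 hE hE2
    have q0 : ∀ i j, MixedLoc.Q E (MixedLoc.gv K idx i) (lam i) (MixedLoc.gv K idx j) (lam j) := by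
      intro i j
      rw [← hphi, ← hphi]
      exact MixedLoc.t_Q _ h (hD.1.2 i j)
    have j0 : ∀ i j k, MixedLoc.J E (MixedLoc.gv K idx i) (lam i) (MixedLoc.gv K idx j) (lam j)
        (MixedLoc.gv K idx k) := by
      intro i j k
      rw [← hphi, ← hphi, ← hphi]
      exact MixedLoc.t_J _ h (hD.2 i j k)
    have q1 : ∀ i (t : Fin d ⊕ Fin r), MixedLoc.Q E (MixedLoc.gv K idx i) (lam i)
        (MixedLoc.q K idx (FreeAlgebra.ι K t)) (Sum.elim lam (fun α : Fin r => - lam (idx α)) t) := by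
      rintro i (j | α)
      · exact q0 i j
      · exact MixedLoc.Q.inv_right hE (MixedLoc.vw α) (MixedLoc.wv α) (q0 _ _)
    have j1 : ∀ i j (u : Fin d ⊕ Fin r), MixedLoc.J E (MixedLoc.gv K idx i) (lam i)
        (MixedLoc.gv K idx j) (lam j) (MixedLoc.q K idx (FreeAlgebra.ι K u)) := by
      rintro i j (k | α)
      · exact j0 i j k
      · exact MixedLoc.J.inv3 hE (MixedLoc.vw α) (MixedLoc.wv α) (j0 _ _ _)
    have j2 : ∀ i (t u : Fin d ⊕ Fin r), MixedLoc.J E (MixedLoc.gv K idx i) (lam i)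
        (MixedLoc.q K idx (FreeAlgebra.ι K t)) (Sum.elim lam (fun α : Fin r => - lam (idx α)) t)
        (MixedLoc.q K idx (FreeAlgebra.ι K u)) := by
      rintro i (j | α) u
      · exact j1 i j u
      · exact MixedLoc.J.inv2 hE (MixedLoc.vw α) (MixedLoc.wv α) (j1 _ _ _)
    refine ⟨⟨hE, ?_⟩, ?_⟩
    · rintro (i | α) t
      · exact q1 i t
      · exact MixedLoc.Q.inv_left hE (MixedLoc.vw α) (MixedLoc.wv α) (q1 _ _)
    · rintro (i | α) t u
      · exact j2 i t u
      · exact MixedLoc.J.inv1 hE (MixedLoc.vw α) (MixedLoc.wv α) (q1 _ _).symm (j2 _ _ _)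
end

section
/- Let K be an algebraically closed field of characteristic zero and d ≥ 1. Let L = K[F_d] be the group algebra over K of the free group F_d on generators g1,…,gd (the algebra of noncommutative Laurent polynomials K⟨v1^{±1},…,vd^{±1}⟩), and let φ : K⟨v1,…,vd⟩ → L be the algebra homomorphism sending v_i to g_i. If ⟪-,-⟫ is a mixed double Poisson algebra structure on K⟨v1,…,vd⟩ of weight (λ1,…,λd) ∈ K^d, then there exists a unique K-linear map ⟪-,-⟫_L : L⊗L → L⊗L satisfying the Leibniz rules such that ⟪g_i,g_j⟫_L = (φ⊗φ)(⟪v_i,v_j⟫) for all 1≤i,j≤d; this map is a mixed double Poisson algebra structure on L of weight (λ1,…,λd,−λ1,…,−λd) with respect to the generators g1,…,gd,g1^{−1},…,gd^{−1}, and in particular it is a modified double Poisson bracket on L. -/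
open TensorProduct

/-- The map `φ : K⟨v1,…,vd⟩ → K[F_d]` sending `v_i` to `g_i`. -/
noncomputable def laurentPhi (K : Type*) [Field K] (d : ℕ) :
    FreeAlgebra K (Fin d) →ₐ[K] MonoidAlgebra K (FreeGroup (Fin d)) :=
  FreeAlgebra.lift K
    (fun i => MonoidAlgebra.of K (FreeGroup (Fin d)) (FreeGroup.of i))


set_option linter.all false

section TripleTensor

variable {K : Type*} [Field K] {A : Type*} [Ring A] [Algebra K A]

variable (K A) in
noncomputable def i12 : A ⊗[K] A →ₐ[K] (A ⊗[K] A) ⊗[K] A := Algebra.TensorProduct.includeLeft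
variable (K A) in
noncomputable def i13 : A ⊗[K] A →ₐ[K] (A ⊗[K] A) ⊗[K] A :=
  Algebra.TensorProduct.map Algebra.TensorProduct.includeLeft (AlgHom.id K A)
variable (K A) in
noncomputable def i23 : A ⊗[K] A →ₐ[K] (A ⊗[K] A) ⊗[K] A :=
  Algebra.TensorProduct.map Algebra.TensorProduct.includeRight (AlgHom.id K A)
variable (K A) in
noncomputable def e1 : A →ₐ[K] (A ⊗[K] A) ⊗[K] A :=
  (i12 K A).comp Algebra.TensorProduct.includeLeft
variable (K A) in
noncomputable def e2 : A →ₐ[K] (A ⊗[K] A) ⊗[K] A :=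
  (i12 K A).comp Algebra.TensorProduct.includeRight
variable (K A) in
noncomputable def e3 : A →ₐ[K] (A ⊗[K] A) ⊗[K] A := Algebra.TensorProduct.includeRight

lemma e1_apply (a : A) : e1 K A a = (a ⊗ₜ 1) ⊗ₜ 1 := rfl
lemma e2_apply (a : A) : e2 K A a = (1 ⊗ₜ a) ⊗ₜ 1 := rfl
lemma e3_apply (a : A) : e3 K A a = 1 ⊗ₜ a := rfl
lemma i12_apply (w : A ⊗[K] A) : i12 K A w = w ⊗ₜ 1 := rfl
lemma i13_tmul (a b : A) : i13 K A (a ⊗ₜ b) = (a ⊗ₜ 1) ⊗ₜ b := by simp [i13]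
lemma i23_tmul (a b : A) : i23 K A (a ⊗ₜ b) = (1 ⊗ₜ a) ⊗ₜ b := by simp [i23]

lemma i12_l (a : A) : i12 K A (a ⊗ₜ 1) = e1 K A a := rfl
lemma i12_r (a : A) : i12 K A (1 ⊗ₜ a) = e2 K A a := rfl
lemma i13_l (a : A) : i13 K A (a ⊗ₜ 1) = e1 K A a := by rw [i13_tmul, e1_apply]
lemma i13_r (a : A) : i13 K A (1 ⊗ₜ a) = e3 K A a := by rw [i13_tmul, e3_apply]; rfl
lemma i23_l (a : A) : i23 K A (a ⊗ₜ 1) = e2 K A a := by rw [i23_tmul, e2_apply]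
lemma i23_r (a : A) : i23 K A (1 ⊗ₜ a) = e3 K A a := by rw [i23_tmul, e3_apply]; rfl
lemma i12_t (a b : A) : i12 K A (a ⊗ₜ b) = e1 K A a * e2 K A b := by
  simp [i12_apply, e1_apply, e2_apply]
lemma i13_t (a b : A) : i13 K A (a ⊗ₜ b) = e1 K A a * e3 K A b := by
  simp [i13_tmul, e1_apply, e3_apply]
lemma i23_t (a b : A) : i23 K A (a ⊗ₜ b) = e2 K A a * e3 K A b := by
  simp [i23_tmul, e2_apply, e3_apply]

lemma c21 (a b : A) : e2 K A b * e1 K A a = e1 K A a * e2 K A b := by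
  simp [e2_apply, e1_apply]
lemma c31 (a b : A) : e3 K A b * e1 K A a = e1 K A a * e3 K A b := by
  simp [e3_apply, e1_apply]
lemma c32 (a b : A) : e3 K A b * e2 K A a = e2 K A a * e3 K A b := by
  simp [e3_apply, e2_apply]
lemma ci3 (w : A ⊗[K] A) (a : A) : i12 K A w * e3 K A a = e3 K A a * i12 K A w := by
  simp [i12_apply, e3_apply]
lemma ci2 (w : A ⊗[K] A) (a : A) : i13 K A w * e2 K A a = e2 K A a * i13 K A w := by
  induction w with
  | zero => simp
  | add x y hx hy => simp [add_mul, mul_add, hx, hy]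
  | tmul x y => simp [i13_tmul, e2_apply]
lemma ci1 (w : A ⊗[K] A) (a : A) : i23 K A w * e1 K A a = e1 K A a * i23 K A w := by
  induction w with
  | zero => simp
  | add x y hx hy => simp [add_mul, mul_add, hx, hy]
  | tmul x y => simp [i23_tmul, e1_apply]

lemma assoc_of_comm {R : Type*} [Ring R] {x y : R} (h : x * y = y * x) (z : R) :
    x * (y * z) = y * (x * z) := by rw [← mul_assoc, h, mul_assoc]

lemma c21' (a b : A) (z) : e2 K A b * (e1 K A a * z) = e1 K A a * (e2 K A b * z) :=
  assoc_of_comm (c21 a b) z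
lemma c31' (a b : A) (z) : e3 K A b * (e1 K A a * z) = e1 K A a * (e3 K A b * z) :=
  assoc_of_comm (c31 a b) z
lemma c32' (a b : A) (z) : e3 K A b * (e2 K A a * z) = e2 K A a * (e3 K A b * z) :=
  assoc_of_comm (c32 a b) z
lemma ci3' (w : A ⊗[K] A) (a : A) (z) :
    i12 K A w * (e3 K A a * z) = e3 K A a * (i12 K A w * z) := assoc_of_comm (ci3 w a) z
lemma ci2' (w : A ⊗[K] A) (a : A) (z) :
    i13 K A w * (e2 K A a * z) = e2 K A a * (i13 K A w * z) := assoc_of_comm (ci2 w a) z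
lemma ci1' (w : A ⊗[K] A) (a : A) (z) :
    i23 K A w * (e1 K A a * z) = e1 K A a * (i23 K A w * z) := assoc_of_comm (ci1 w a) z

lemma otimes1_eq (c : A) (w : A ⊗[K] A) : otimes1 K A c w = e2 K A c * i13 K A w := by
  induction w with
  | zero => simp
  | add x y hx hy => simp [mul_add, hx, hy]
  | tmul x y => simp [i13_tmul, e2_apply, otimes1]

variable (D : A ⊗[K] A →ₗ[K] A ⊗[K] A)

lemma dL_t (a x y : A) : dL K A D a (x ⊗ₜ y) = i12 K A (D (a ⊗ₜ x)) * e3 K A y := by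
  simp [dL, i12_apply, e3_apply]

lemma dR_t (a x y : A) : dR K A D a (x ⊗ₜ y) = e1 K A x * i23 K A (D (a ⊗ₜ y)) := by
  simp only [dR, LinearMap.comp_apply, LinearMap.lTensor_tmul, TensorProduct.mk_apply]
  generalize D (a ⊗ₜ y) = w
  induction w with
  | zero => simp
  | add u v hu hv => rw [tmul_add, map_add, hu, hv, map_add, mul_add]
  | tmul u v => simp [e1_apply, i23_tmul]

lemma dLfst_t (c x y : A) :
    dLfst K A D c (x ⊗ₜ y) = e2 K A y * i13 K A (D (x ⊗ₜ c)) := by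
  simp only [dLfst, LinearMap.comp_apply, LinearMap.rTensor_tmul, LinearMap.flip_apply,
    TensorProduct.mk_apply]
  generalize D (x ⊗ₜ c) = w
  induction w with
  | zero => simp
  | add u v hu hv => rw [add_tmul, map_add, hu, hv, map_add, mul_add]
  | tmul u v => simp [e2_apply, i13_tmul, swap23]



lemma flipT_tmul (x y : A) : flipT K A (x ⊗ₜ y) = y ⊗ₜ x := rfl

lemma flipT_mul (x y : A ⊗[K] A) : flipT K A (x * y) = flipT K A x * flipT K A y :=
  map_mul (Algebra.TensorProduct.comm K A A) x y

lemma flipT_flipT (x : A ⊗[K] A) : flipT K A (flipT K A x) = x := by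
  simp [flipT]

/-- The failure of skew-symmetry. -/
noncomputable def SS (D : A ⊗[K] A →ₗ[K] A ⊗[K] A) (a b : A) : A ⊗[K] A :=
  D (a ⊗ₜ b) + flipT K A (D (b ⊗ₜ a))


section LeibnizLemmas

variable {D} (hD : LeibnizRules K A D)
include hD

lemma dL_lmul (a c : A) (w : A ⊗[K] A) : dL K A D a ((c ⊗ₜ 1) * w) =
    e1 K A c * dL K A D a w + i12 K A (D (a ⊗ₜ c)) * i23 K A w := by
  induction w with
  | zero => simp
  | add x y hx hy => simp only [mul_add, map_add, hx, hy]; abel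
  | tmul x y =>
    simp only [Algebra.TensorProduct.tmul_mul_tmul, one_mul, dL_t, hD.1, map_add, map_mul, add_mul,
      i12_l, i12_r, i23_t, mul_assoc]

lemma dL_rmul (a c : A) (w : A ⊗[K] A) : dL K A D a (w * (1 ⊗ₜ c)) =
    dL K A D a w * e3 K A c := by
  induction w with
  | zero => simp
  | add x y hx hy => simp only [add_mul, map_add, hx, hy]
  | tmul x y =>
    simp only [Algebra.TensorProduct.tmul_mul_tmul, mul_one, dL_t, map_mul, mul_assoc]

lemma dR_lmul (b c : A) (w : A ⊗[K] A) : dR K A D b ((c ⊗ₜ 1) * w) =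
    e1 K A c * dR K A D b w := by
  induction w with
  | zero => simp
  | add x y hx hy => simp only [mul_add, map_add, hx, hy]
  | tmul x y =>
    simp only [Algebra.TensorProduct.tmul_mul_tmul, one_mul, dR_t, map_mul, mul_assoc]

lemma dR_rmul (b c : A) (u : A ⊗[K] A) : dR K A D b (u * (1 ⊗ₜ c)) =
    i12 K A u * i23 K A (D (b ⊗ₜ c)) + dR K A D b u * e3 K A c := by
  induction u with
  | zero => simp
  | add x y hx hy => simp only [add_mul, map_add, hx, hy]; abel
  | tmul x y =>
    simp only [Algebra.TensorProduct.tmul_mul_tmul, mul_one, dR_t, hD.1, map_add, map_mul, add_mul,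
      mul_add, i23_l, i23_r, i12_t, mul_assoc]

lemma dLfst_mul (c c' : A) (w : A ⊗[K] A) : dLfst K A D (c * c') w =
    e1 K A c * dLfst K A D c' w + dLfst K A D c w * e3 K A c' := by
  induction w with
  | zero => simp
  | add x y hx hy => simp only [mul_add, add_mul, map_add, hx, hy]; abel
  | tmul x y =>
    simp only [dLfst_t, hD.1, map_add, map_mul, add_mul,
      mul_add, i13_l, i13_r, mul_assoc, c21']

lemma dL_mul (a a' : A) (w : A ⊗[K] A) : dL K A D (a * a') w =
    e2 K A a * dL K A D a' w + dL K A D a w * e1 K A a' := by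
  induction w with
  | zero => simp
  | add x y hx hy => simp only [mul_add, add_mul, map_add, hx, hy]; abel
  | tmul x y =>
    simp only [dL_t, hD.2, map_add, map_mul, add_mul,
      mul_add, i12_l, i12_r, mul_assoc, c31]

lemma dR_lmul2 (b a : A) (u : A ⊗[K] A) : dR K A D b ((1 ⊗ₜ a) * u) =
    e2 K A a * dR K A D b u + i23 K A (D (b ⊗ₜ a)) * i13 K A u := by
  induction u with
  | zero => simp
  | add x y hx hy => simp only [mul_add, map_add, hx, hy]; abel
  | tmul x y =>
    simp only [Algebra.TensorProduct.tmul_mul_tmul, one_mul, dR_t, hD.1, map_add, map_mul, add_mul,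
      mul_add, i23_l, i23_r, i13_t, mul_assoc, c21', ci1']

lemma dR_rmul1 (b a : A) (u : A ⊗[K] A) : dR K A D b (u * (a ⊗ₜ 1)) =
    dR K A D b u * e1 K A a := by
  induction u with
  | zero => simp
  | add x y hx hy => simp only [add_mul, map_add, hx, hy]
  | tmul x y =>
    simp only [Algebra.TensorProduct.tmul_mul_tmul, mul_one, dR_t, map_mul, mul_assoc, ci1]

lemma dLfst_lmul2 (c a : A) (w : A ⊗[K] A) : dLfst K A D c ((1 ⊗ₜ a) * w) =
    e2 K A a * dLfst K A D c w := by
  induction w with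
  | zero => simp
  | add x y hx hy => simp only [mul_add, map_add, hx, hy]
  | tmul x y =>
    simp only [Algebra.TensorProduct.tmul_mul_tmul, one_mul, dLfst_t, map_mul, mul_assoc]

lemma dLfst_rmul1 (c a : A) (w : A ⊗[K] A) : dLfst K A D c (w * (a ⊗ₜ 1)) =
    i23 K A (flipT K A w) * i13 K A (D (a ⊗ₜ c)) + dLfst K A D c w * e1 K A a := by
  induction w with
  | zero => simp
  | add x y hx hy => simp only [add_mul, map_add, hx, hy]; abel
  | tmul x y =>
    simp only [Algebra.TensorProduct.tmul_mul_tmul, mul_one, dLfst_t, hD.2, map_add, map_mul,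
      mul_add, i13_l, i13_r, i23_t, mul_assoc, flipT_tmul]

lemma dL_rmul1 (a b : A) (w : A ⊗[K] A) : dL K A D a (w * (b ⊗ₜ 1)) =
    i13 K A w * i12 K A (D (a ⊗ₜ b)) + dL K A D a w * e2 K A b := by
  induction w with
  | zero => simp
  | add x y hx hy => simp only [add_mul, map_add, hx, hy]; abel
  | tmul x y =>
    simp only [Algebra.TensorProduct.tmul_mul_tmul, mul_one, dL_t, hD.1, map_add, map_mul, add_mul,
      i12_l, i12_r, i13_t, mul_assoc, ci3]
    congr 1
    rw [← c32, ci3']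

lemma dL_lmul2 (a b : A) (w : A ⊗[K] A) : dL K A D a ((1 ⊗ₜ b) * w) =
    e3 K A b * dL K A D a w := by
  induction w with
  | zero => simp
  | add x y hx hy => simp only [mul_add, map_add, hx, hy]
  | tmul x y =>
    simp only [Algebra.TensorProduct.tmul_mul_tmul, one_mul, dL_t, map_mul, ci3']

lemma dR_mul (b b' : A) (w : A ⊗[K] A) : dR K A D (b * b') w =
    e3 K A b * dR K A D b' w + dR K A D b w * e2 K A b' := by
  induction w with
  | zero => simp
  | add x y hx hy => simp only [mul_add, add_mul, map_add, hx, hy]; abel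
  | tmul x y =>
    simp only [dR_t, hD.2, map_add, map_mul,
      mul_add, i23_l, i23_r, mul_assoc, c31']

lemma dLfst_lmul (c b : A) (w : A ⊗[K] A) : dLfst K A D c ((b ⊗ₜ 1) * w) =
    e3 K A b * dLfst K A D c w + i13 K A (D (b ⊗ₜ c)) * i12 K A w := by
  induction w with
  | zero => simp
  | add x y hx hy => simp only [mul_add, map_add, hx, hy]; abel
  | tmul x y =>
    simp only [Algebra.TensorProduct.tmul_mul_tmul, one_mul, dLfst_t, hD.2, map_add, map_mul,
      mul_add, i13_l, i13_r, i12_t, mul_assoc, c32']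
    congr 1
    rw [← c21, ci2']

lemma dLfst_rmul (c b : A) (w : A ⊗[K] A) : dLfst K A D c (w * (1 ⊗ₜ b)) =
    dLfst K A D c w * e2 K A b := by
  induction w with
  | zero => simp
  | add x y hx hy => simp only [add_mul, map_add, hx, hy]
  | tmul x y =>
    simp only [Algebra.TensorProduct.tmul_mul_tmul, mul_one, dLfst_t, map_mul, mul_assoc, ci2]

lemma DJac_mul3 (a b c c' : A) : DJac K A D a b (c * c') =
    e1 K A c * DJac K A D a b c' + DJac K A D a b c * e3 K A c' := by
  simp only [DJac, hD.1, map_add, dL_lmul hD, dL_rmul hD, dR_lmul hD, dR_rmul hD, dLfst_mul hD,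
    mul_sub, sub_mul]
  abel

lemma DJac_mul2 (a b b' c : A) : DJac K A D a (b * b') c =
    e3 K A b * DJac K A D a b' c + DJac K A D a b c * e2 K A b' := by
  simp only [DJac, hD.1, hD.2, map_add, dL_lmul2 hD, dL_rmul1 hD, dR_mul hD, dLfst_lmul hD,
    dLfst_rmul hD, mul_sub, sub_mul]
  abel

lemma DJac_mul1 (a a' b c : A) : DJac K A D (a * a') b c =
    e2 K A a * DJac K A D a' b c + DJac K A D a b c * e1 K A a'
      - i23 K A (SS D b a) * i13 K A (D (a' ⊗ₜ c)) := by
  simp only [DJac, hD.1, hD.2, map_add, dL_mul hD, dR_lmul2 hD, dR_rmul1 hD, dLfst_lmul2 hD,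
    dLfst_rmul1 hD, mul_sub, sub_mul, SS, add_mul]
  abel

lemma SS_flip (a b : A) : flipT K A (SS D a b) = SS D b a := by
  simp only [SS, map_add, flipT_flipT]; abel

lemma SS_mul2 (a b c : A) : SS D a (b * c) =
    (b ⊗ₜ 1) * SS D a c + SS D a b * (1 ⊗ₜ c) := by
  simp only [SS, hD.1, hD.2, map_add, flipT_mul, flipT_tmul, mul_add, add_mul]
  abel

lemma SS_mul1 (a b c : A) : SS D (a * b) c =
    (1 ⊗ₜ a) * SS D b c + SS D a c * (b ⊗ₜ 1) := by
  simp only [SS, hD.1, hD.2, map_add, flipT_mul, flipT_tmul, mul_add, add_mul]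
  abel

lemma D_one_left (c : A) : D (1 ⊗ₜ c) = 0 := by
  have := hD.2 1 1 c
  simpa [← Algebra.TensorProduct.one_def] using this

lemma D_one_right (c : A) : D (c ⊗ₜ 1) = 0 := by
  have := hD.1 c 1 1
  simpa [← Algebra.TensorProduct.one_def] using this

end LeibnizLemmas

section Linearity

lemma dL_add' (a a' : A) (w : A ⊗[K] A) :
    dL K A D (a + a') w = dL K A D a w + dL K A D a' w := by
  simp only [dL, map_add, LinearMap.comp_add, LinearMap.rTensor_add, LinearMap.add_apply]
lemma dL_smul' (k : K) (a : A) (w : A ⊗[K] A) :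
    dL K A D (k • a) w = k • dL K A D a w := by
  simp only [dL, map_smul, LinearMap.comp_smul, LinearMap.rTensor_smul, LinearMap.smul_apply]
lemma dR_add' (a a' : A) (w : A ⊗[K] A) :
    dR K A D (a + a') w = dR K A D a w + dR K A D a' w := by
  simp only [dR, map_add, LinearMap.comp_add, LinearMap.lTensor_add, LinearMap.add_apply]
lemma dR_smul' (k : K) (a : A) (w : A ⊗[K] A) :
    dR K A D (k • a) w = k • dR K A D a w := by
  simp only [dR, map_smul, LinearMap.comp_smul, LinearMap.lTensor_smul, LinearMap.smul_apply]
lemma dLfst_add' (a a' : A) (w : A ⊗[K] A) :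
    dLfst K A D (a + a') w = dLfst K A D a w + dLfst K A D a' w := by
  simp only [dLfst, map_add, LinearMap.comp_add, LinearMap.rTensor_add, LinearMap.add_apply]
lemma dLfst_smul' (k : K) (a : A) (w : A ⊗[K] A) :
    dLfst K A D (k • a) w = k • dLfst K A D a w := by
  simp only [dLfst, map_smul, LinearMap.comp_smul, LinearMap.rTensor_smul, LinearMap.smul_apply]

lemma DJac_add1 (a a' b c : A) :
    DJac K A D (a + a') b c = DJac K A D a b c + DJac K A D a' b c := by
  simp only [DJac, add_tmul, map_add, dL_add']; abel
lemma DJac_add2 (a b b' c : A) :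
    DJac K A D a (b + b') c = DJac K A D a b c + DJac K A D a b' c := by
  simp only [DJac, add_tmul, tmul_add, map_add, dR_add']; abel
lemma DJac_add3 (a b c c' : A) :
    DJac K A D a b (c + c') = DJac K A D a b c + DJac K A D a b c' := by
  simp only [DJac, tmul_add, map_add, dLfst_add']; abel
lemma DJac_smul1 (k : K) (a b c : A) : DJac K A D (k • a) b c = k • DJac K A D a b c := by
  simp only [DJac, ← smul_tmul', map_smul, dL_smul', smul_sub]
lemma DJac_smul2 (k : K) (a b c : A) : DJac K A D a (k • b) c = k • DJac K A D a b c := by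
  simp only [DJac, ← smul_tmul', tmul_smul, map_smul, dR_smul', smul_sub]
lemma DJac_smul3 (k : K) (a b c : A) : DJac K A D a b (k • c) = k • DJac K A D a b c := by
  simp only [DJac, tmul_smul, map_smul, dLfst_smul', smul_sub]

lemma SS_add1 (a a' b : A) : SS D (a + a') b = SS D a b + SS D a' b := by
  simp only [SS, tmul_add, add_tmul, map_add]; abel
lemma SS_add2 (a a' b : A) : SS D b (a + a') = SS D b a + SS D b a' := by
  simp only [SS, tmul_add, add_tmul, map_add]; abel
lemma SS_smul1 (k : K) (a b : A) : SS D (k • a) b = k • SS D a b := by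
  simp only [SS, tmul_smul, ← smul_tmul', map_smul, smul_add]
lemma SS_smul2 (k : K) (a b : A) : SS D b (k • a) = k • SS D b a := by
  simp only [SS, tmul_smul, ← smul_tmul', map_smul, smul_add]

variable {D} (hD : LeibnizRules K A D)
include hD

lemma DJac_one1 (b c : A) : DJac K A D 1 b c = 0 := by
  have := DJac_mul1 hD 1 1 b c
  simpa [D_one_left hD] using this
lemma DJac_one2 (b c : A) : DJac K A D b 1 c = 0 := by
  have := DJac_mul2 hD b 1 1 c
  simpa [D_one_left hD] using this
lemma DJac_one3 (b c : A) : DJac K A D b c 1 = 0 := by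
  have := DJac_mul3 hD b c 1 1
  simpa [D_one_left hD] using this
lemma SS_one1 (c : A) : SS D 1 c = 0 := by
  simp [SS, D_one_left hD, D_one_right hD]
lemma SS_one2 (c : A) : SS D c 1 = 0 := by
  simp [SS, D_one_left hD, D_one_right hD]

end Linearity

lemma gen_ind {ι : Type*} {u : ι → A} (hgen : Algebra.adjoin K (Set.range u) = ⊤)
    {p : A → Prop} (hu : ∀ i, p (u i)) (h1 : p 1) (hs : ∀ (k : K) a, p a → p (k • a))
    (ha : ∀ a b, p a → p b → p (a + b)) (hm : ∀ a b, p a → p b → p (a * b)) (a : A) : p a := by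
  have hmem : a ∈ Algebra.adjoin K (Set.range u) := by rw [hgen]; trivial
  induction hmem using Algebra.adjoin_induction with
  | mem x hx => obtain ⟨i, rfl⟩ := hx; exact hu i
  | algebraMap r => rw [Algebra.algebraMap_eq_smul_one]; exact hs _ _ h1
  | add x y _ _ hx hy => exact ha _ _ hx hy
  | mul x y _ _ hx hy => exact hm _ _ hx hy

section Modified

variable {ι : Type*} {u : ι → A} {mu : ι → K}

/-- Inner double derivations -/
def InnerDer (P : A →ₗ[K] A ⊗[K] A) : Prop :=
  ∀ a b, P (a * b) = (1 ⊗ₜ a) * P b + P a * (b ⊗ₜ 1)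

variable {D} {P : A →ₗ[K] A ⊗[K] A}

lemma InnerDer.one (hP : InnerDer P) : P 1 = 0 := by
  have := hP 1 1
  simpa [← Algebra.TensorProduct.one_def] using this

lemma tcomm (a b : A) (w : A ⊗[K] A) : (a ⊗ₜ 1) * ((1 ⊗ₜ b) * w) = (1 ⊗ₜ b) * ((a ⊗ₜ 1) * w) := by
  rw [← mul_assoc, ← mul_assoc]; simp

lemma tcomm' (a b : A) : (a ⊗ₜ[K] (1 : A)) * ((1 : A) ⊗ₜ[K] b) = (1 ⊗ₜ b) * (a ⊗ₜ 1) := by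
  simp

lemma SS_formula (hgen : Algebra.adjoin K (Set.range u) = ⊤) (hD : IsMixedDouble K A u mu D)
    (hP : InnerDer P) (hPu : ∀ i, P (u i) = (mu i / 2) • (u i ⊗ₜ 1 + 1 ⊗ₜ u i)) (a c : A) :
    SS D a c = P a * (1 ⊗ₜ c) - (c ⊗ₜ 1) * P a + flipT K A (P c) * (a ⊗ₜ 1)
      - (1 ⊗ₜ a) * flipT K A (P c) := by
  have hL := hD.1
  revert c
  refine gen_ind hgen (p := fun a => ∀ c, SS D a c = P a * (1 ⊗ₜ c) - (c ⊗ₜ 1) * P a +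
    flipT K A (P c) * (a ⊗ₜ 1) - (1 ⊗ₜ a) * flipT K A (P c)) ?_ ?_ ?_ ?_ ?_ a
  · intro i
    refine gen_ind hgen ?_ ?_ ?_ ?_ ?_
    · intro j
      rw [SS, hD.2 i j, hPu, hPu]
      simp only [map_smul, map_add, flipT_tmul, smul_mul_assoc, mul_smul_comm, add_mul, mul_add,
        Algebra.TensorProduct.tmul_mul_tmul, one_mul, mul_one]
      module
    · rw [SS_one2 hL, hP.one]; simp [← Algebra.TensorProduct.one_def]
    · intro k c hc
      rw [SS_smul2, hc]
      simp only [map_smul, tmul_smul, ← smul_tmul', mul_smul_comm, smul_mul_assoc, smul_add, smul_sub]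
    · intro c c' hc hc'
      rw [SS_add2, hc, hc']
      simp only [map_add, tmul_add, add_tmul, mul_add, add_mul]
      abel
    · intro c c' hc hc'
      rw [SS_mul2 hL, hc, hc', hP]
      have h1 : ((1:A) ⊗ₜ[K] (c * c')) = (1 ⊗ₜ c) * (1 ⊗ₜ c') := by simp
      have h2 : ((c * c') ⊗ₜ[K] (1:A)) = (c ⊗ₜ 1) * (c' ⊗ₜ 1) := by simp
      simp only [h1, h2, map_add, flipT_mul, flipT_tmul, mul_add, mul_sub, add_mul, sub_mul,
        mul_assoc, tcomm, tcomm']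
      abel
  · intro c
    rw [SS_one1 hL, hP.one]; simp [← Algebra.TensorProduct.one_def]
  · intro k a ha c
    rw [SS_smul1, ha]
    simp only [map_smul, tmul_smul, ← smul_tmul', mul_smul_comm, smul_mul_assoc, smul_add, smul_sub]
  · intro a a' ha ha' c
    rw [SS_add1, ha, ha']
    simp only [map_add, tmul_add, add_tmul, mul_add, add_mul]
    abel
  · intro a a' ha ha' c
    rw [SS_mul1 hL, ha, ha', hP]
    have h1 : ((1:A) ⊗ₜ[K] (a * a')) = (1 ⊗ₜ a) * (1 ⊗ₜ a') := by simp
    have h2 : ((a * a') ⊗ₜ[K] (1:A)) = (a ⊗ₜ 1) * (a' ⊗ₜ 1) := by simp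
    simp only [h1, h2, map_add, flipT_mul, flipT_tmul, mul_add, mul_sub, add_mul, sub_mul,
      mul_assoc, tcomm, tcomm']
    abel

lemma DJac_formula (hgen : Algebra.adjoin K (Set.range u) = ⊤)
    (hD : IsMixedDoublePoisson K A u mu D)
    (hP : InnerDer P) (hPu : ∀ i, P (u i) = (mu i / 2) • (u i ⊗ₜ 1 + 1 ⊗ₜ u i)) (a c : A) :
    ∃ R, ∀ b, DJac K A D a b c = (e3 K A b * R - R * e2 K A b)
      - i23 K A (P b) * i13 K A (D (a ⊗ₜ c)) := by
  have hL := hD.1.1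
  refine gen_ind hgen (p := fun a => ∃ R, ∀ b, DJac K A D a b c =
    (e3 K A b * R - R * e2 K A b) - i23 K A (P b) * i13 K A (D (a ⊗ₜ c))) ?_ ?_ ?_ ?_ ?_ a
  · intro i
    refine ⟨(mu i / 2) • i13 K A (D (u i ⊗ₜ c)), ?_⟩
    refine gen_ind hgen ?_ ?_ ?_ ?_ ?_
    · intro j
      refine gen_ind hgen (p := fun c => DJac K A D (u i) (u j) c =
        (e3 K A (u j) * (mu i / 2) • i13 K A (D (u i ⊗ₜ c))
          - ((mu i / 2) • i13 K A (D (u i ⊗ₜ c))) * e2 K A (u j))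
          - i23 K A (P (u j)) * i13 K A (D (u i ⊗ₜ c))) ?_ ?_ ?_ ?_ ?_ c
      · intro k
        rw [hD.2 i j k, hPu]
        simp only [otimes1_eq, map_one, one_mul, map_mul, i13_r, map_smul, map_add, i23_l, i23_r,
          smul_mul_assoc, mul_smul_comm, add_mul, ci2]
        module
      · rw [DJac_one3 hL, D_one_right hL]; simp
      · intro k c hc
        rw [DJac_smul3, hc]
        simp only [map_smul, tmul_smul, mul_smul_comm, smul_mul_assoc, smul_sub, smul_neg,
          smul_comm (mu i / 2) k]
      · intro c c' hc hc'
        rw [DJac_add3, hc, hc']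
        simp only [map_add, tmul_add, mul_add, add_mul, smul_add]
        abel
      · intro c c' hc hc'
        rw [DJac_mul3 hL, hc, hc', hL.1]
        simp only [map_add, map_mul, mul_add, add_mul, smul_add, mul_sub, sub_mul, mul_neg, neg_mul,
          mul_smul_comm, smul_mul_assoc, i13_l, i13_r, mul_assoc, ci1', c31', c32, ci2, ci2']
        abel
    · rw [DJac_one2 hL, hP.one]; simp
    · intro k b hb
      rw [DJac_smul2, hb]
      simp only [map_smul, tmul_smul, mul_smul_comm, smul_mul_assoc, smul_sub, smul_neg,
        smul_comm (mu i / 2) k]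
    · intro b b' hb hb'
      rw [DJac_add2, hb, hb']
      simp only [map_add, mul_add, add_mul, smul_add]
      abel
    · intro b b' hb hb'
      rw [DJac_mul2 hL, hb, hb', hP]
      simp only [map_add, map_mul, mul_add, add_mul, smul_add, mul_sub, sub_mul, mul_neg, neg_mul,
        mul_smul_comm, smul_mul_assoc, i23_l, i23_r, mul_assoc, c32', ci2, ci2']
      abel
  · exact ⟨0, fun b => by rw [DJac_one1 hL, D_one_left hL]; simp⟩
  · rintro k a ⟨R, hR⟩
    refine ⟨k • R, fun b => ?_⟩
    rw [DJac_smul1, hR]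
    simp only [map_smul, ← smul_tmul', mul_smul_comm, smul_mul_assoc, smul_sub, smul_neg]
  · rintro a a' ⟨R, hR⟩ ⟨R', hR'⟩
    refine ⟨R + R', fun b => ?_⟩
    rw [DJac_add1, hR, hR']
    simp only [map_add, add_tmul, mul_add, add_mul]
    abel
  · rintro a a' ⟨R, hR⟩ ⟨R', hR'⟩
    refine ⟨e2 K A a * R' + R * e1 K A a'
      + i23 K A (flipT K A (P a)) * i13 K A (D (a' ⊗ₜ c)), fun b => ?_⟩
    rw [DJac_mul1 hL, hR, hR', SS_formula hgen hD.1 hP hPu, hL.2]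
    simp only [map_add, map_sub, map_mul, mul_add, add_mul, mul_sub, sub_mul, mul_neg, neg_mul,
      i23_l, i23_r, i13_l, i13_r, mul_assoc, c32', ci2, ci2', c21, c21', c31']
    abel

variable (K A) in
noncomputable def m3 : (A ⊗[K] A) ⊗[K] A →ₗ[K] A :=
  LinearMap.mul' K A ∘ₗ LinearMap.rTensor A (LinearMap.mul' K A)

lemma m3_e2 (x : (A ⊗[K] A) ⊗[K] A) (b : A) : m3 K A (x * e2 K A b) = m3 K A (e3 K A b * x) := by
  induction x with
  | zero => simp
  | add x y hx hy => simp only [add_mul, mul_add, map_add, hx, hy]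
  | tmul w z =>
    induction w with
    | zero => simp
    | add x y hx hy => simp only [add_tmul, add_mul, mul_add, map_add, hx, hy]
    | tmul x y => simp [m3, e2_apply, e3_apply, mul_assoc]

lemma m3_e1 (x : (A ⊗[K] A) ⊗[K] A) (b : A) : m3 K A (x * e1 K A b) = m3 K A (e2 K A b * x) := by
  induction x with
  | zero => simp
  | add x y hx hy => simp only [add_mul, mul_add, map_add, hx, hy]
  | tmul w z =>
    induction w with
    | zero => simp
    | add x y hx hy => simp only [add_tmul, add_mul, mul_add, map_add, hx, hy]
    | tmul x y => simp [m3, e2_apply, e1_apply, mul_assoc]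

lemma m3_ii (w p : A ⊗[K] A) :
    m3 K A (i13 K A w * i12 K A p) = m3 K A (i23 K A p * i13 K A w) := by
  induction w with
  | zero => simp
  | add x y hx hy => simp only [add_mul, mul_add, map_add, hx, hy]
  | tmul w z =>
    induction p with
    | zero => simp
    | add x y hx hy => simp only [add_mul, mul_add, map_add, hx, hy]
    | tmul x y => simp [m3, i13_tmul, i23_tmul, i12_apply, mul_assoc]

lemma m_flip (w : A ⊗[K] A) :
    LinearMap.mul' K A (flipT K A w) - LinearMap.mul' K A w ∈ commutatorSpan K A := by
  induction w with
  | zero => simp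
  | add x y hx hy =>
    simp only [map_add]
    rw [add_sub_add_comm]; exact add_mem hx hy
  | tmul x y => 
    exact Submodule.subset_span ⟨y, x, by simp [flipT_tmul]⟩

lemma m_r (w : A ⊗[K] A) (c : A) :
    LinearMap.mul' K A (w * (1 ⊗ₜ c)) = LinearMap.mul' K A w * c := by
  induction w with
  | zero => simp
  | add x y hx hy => simp only [add_mul, map_add, hx, hy]
  | tmul x y => simp [mul_assoc]

lemma m_l (w : A ⊗[K] A) (c : A) :
    LinearMap.mul' K A ((c ⊗ₜ 1) * w) = c * LinearMap.mul' K A w := by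
  induction w with
  | zero => simp
  | add x y hx hy => simp only [mul_add, map_add, hx, hy]
  | tmul x y => simp [mul_assoc]

lemma m_i (w : A ⊗[K] A) (c : A) :
    LinearMap.mul' K A (w * (c ⊗ₜ 1)) = LinearMap.mul' K A ((1 ⊗ₜ c) * w) := by
  induction w with
  | zero => simp
  | add x y hx hy => simp only [mul_add, add_mul, map_add, hx, hy]
  | tmul x y => simp [mul_assoc]

lemma m3_i12 (w : A ⊗[K] A) (y : A) :
    m3 K A (i12 K A w * e3 K A y) = LinearMap.mul' K A w * y := by
  simp [m3, i12_apply, e3_apply]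

lemma m3_i23 (w : A ⊗[K] A) (y : A) :
    m3 K A (e1 K A y * i23 K A w) = y * LinearMap.mul' K A w := by
  induction w with
  | zero => simp
  | add x y hx hy => simp only [mul_add, map_add, hx, hy]
  | tmul x y => simp [m3, i23_tmul, e1_apply, mul_assoc]

lemma m3_i13 (w : A ⊗[K] A) (y : A) :
    m3 K A (e2 K A y * i13 K A w) = LinearMap.mul' K A ((1 ⊗ₜ y) * w) := by
  induction w with
  | zero => simp
  | add x y hx hy => simp only [mul_add, map_add, hx, hy]
  | tmul x y => simp [m3, i13_tmul, e2_apply, mul_assoc]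

lemma br_mul_right (hD : LeibnizRules K A D) (a : A) (w : A ⊗[K] A) :
    br K A D a (LinearMap.mul' K A w) = m3 K A (dL K A D a w) + m3 K A (dR K A D a w) := by
  induction w with
  | zero => simp [br]
  | add x y hx hy =>
    simp only [br, map_add, tmul_add] at *
    rw [hx, hy]; abel
  | tmul x y =>
    rw [dL_t, dR_t, m3_i12, m3_i23, LinearMap.mul'_apply, br, hD.1, map_add, m_l, m_r, add_comm]

lemma br_mul_left (hD : LeibnizRules K A D) (c : A) (w : A ⊗[K] A) :
    br K A D (LinearMap.mul' K A w) c =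
      m3 K A (dLfst K A D c w) + m3 K A (dLfst K A D c (flipT K A w)) := by
  induction w with
  | zero => simp [br]
  | add x y hx hy =>
    simp only [br, map_add, add_tmul] at *
    rw [hx, hy]; abel
  | tmul x y =>
    rw [flipT_tmul, dLfst_t, dLfst_t, m3_i13, m3_i13, LinearMap.mul'_apply, br, hD.2, map_add, m_i,
      add_comm]

theorem modified_of_mixed (hgen : Algebra.adjoin K (Set.range u) = ⊤)
    (hD : IsMixedDoublePoisson K A u mu D)
    (hP : InnerDer P) (hPu : ∀ i, P (u i) = (mu i / 2) • (u i ⊗ₜ 1 + 1 ⊗ₜ u i)) :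
    IsModifiedDoublePoisson K A D := by
  have hL := hD.1.1
  refine ⟨hL, fun a b => ?_, fun a b c => ?_⟩
  · have h1 := SS_formula hgen hD.1 hP hPu a b
    have h2 := congrArg (LinearMap.mul' K A) h1
    simp only [map_sub, map_add, m_r, m_l, m_i] at h2
    have h3 : br K A D a b + br K A D b a = (LinearMap.mul' K A (P a) * b
        - b * LinearMap.mul' K A (P a))
        - (LinearMap.mul' K A (flipT K A (D (b ⊗ₜ a))) - LinearMap.mul' K A (D (b ⊗ₜ a))) := by
      simp only [SS, map_add] at h2
      rw [add_sub_cancel_right] at h2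
      rw [← h2, br, br]; abel
    rw [h3]
    exact sub_mem (Submodule.subset_span ⟨_, _, rfl⟩) (m_flip _)
  · obtain ⟨R, hR⟩ := DJac_formula hgen hD hP hPu a c
    obtain ⟨R', hR'⟩ := DJac_formula hgen hD hP hPu b c
    have key : br K A D a (br K A D b c) - br K A D b (br K A D a c) - br K A D (br K A D a b) c
        = m3 K A (DJac K A D a b c) - m3 K A (DJac K A D b a c)
          - m3 K A (dLfst K A D c (SS D b a)) := by
      rw [show br K A D b c = LinearMap.mul' K A (D (b ⊗ₜ c)) from rfl,
        show br K A D a c = LinearMap.mul' K A (D (a ⊗ₜ c)) from rfl,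
        show br K A D a b = LinearMap.mul' K A (D (a ⊗ₜ b)) from rfl,
        br_mul_right hL, br_mul_right hL, br_mul_left hL]
      simp only [DJac, SS, map_add, map_sub]
      abel
    rw [key, hR, hR', SS_formula hgen hD.1 hP hPu]
    simp only [map_sub, map_add, map_neg, dLfst_rmul hL, dLfst_lmul hL, dLfst_rmul1 hL,
      dLfst_lmul2 hL, m3_e2, m3_e1, m3_ii, flipT_flipT]
    abel

end Modified

section Inverse

variable {D}

lemma solve_inv {R : Type*} [Ring R] {lx ly Y Z : R} (h : ly * lx = 1) (h0 : lx * Y + Z = 0) :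
    Y = 0 - ly * Z := by
  have : Z = 0 - lx * Y := by rw [← h0]; abel
  rw [this, mul_sub, ← mul_assoc, h]; simp

/-- The mixed skew-symmetry for a pair of elements with given weights. -/
def Sp (D : A ⊗[K] A →ₗ[K] A ⊗[K] A) (a : A) (al : K) (b : A) (be : K) : Prop :=
  SS D a b = ((al + be) / 2) • (a ⊗ₜ[K] b - b ⊗ₜ[K] a) +
      ((al - be) / 2) • ((1 : A) ⊗ₜ[K] (a * b) - (b * a) ⊗ₜ[K] (1 : A))

lemma Sp_symm {a b : A} {al be : K} (h : Sp D a al b be) : Sp D b be a al := by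
  unfold Sp at *
  have hf : flipT K A (SS D a b) = SS D b a := by
    simp only [SS, map_add, flipT_flipT]; abel
  rw [← hf, h]
  simp only [map_add, map_sub, map_smul, flipT_tmul]
  module

lemma Sp_inv (hD : LeibnizRules K A D) {x y b : A} {al be : K} (hxy : x * y = 1) (hyx : y * x = 1)
    (h : Sp D x al b be) : Sp D y (-al) b be := by
  unfold Sp at *
  have h0 := SS_mul1 hD x y b
  rw [hxy, SS_one1 hD] at h0
  have hyx' : ∀ z, y * (x * z) = z := fun z => by rw [← mul_assoc, hyx, one_mul]
  have h1 := solve_inv (ly := (1 : A) ⊗ₜ[K] y) (by simp [hyx, Algebra.TensorProduct.one_def]) h0.symm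
  rw [h1, h]
  simp only [mul_add, add_mul, mul_sub, sub_mul, smul_mul_assoc, mul_smul_comm,
    Algebra.TensorProduct.tmul_mul_tmul, one_mul, mul_one, hyx, hxy, hyx', mul_assoc]
  module

/-- The mixed Poisson property for a triple of elements. -/
def Jp (D : A ⊗[K] A →ₗ[K] A ⊗[K] A) (a : A) (al : K) (b : A) (be : K) (c : A) : Prop :=
  DJac K A D a b c =
      (-((al + be) / 2)) • otimes1 K A b (D (a ⊗ₜ[K] c)) +
      ((al - be) / 2) •
        otimes1 K A (1 : A) (((1 : A) ⊗ₜ[K] b) * D (a ⊗ₜ[K] c))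

lemma Jp_iff (a : A) (al : K) (b : A) (be : K) (c : A) : Jp D a al b be c ↔
    DJac K A D a b c = (-((al + be) / 2)) • (e2 K A b * i13 K A (D (a ⊗ₜ[K] c))) +
      ((al - be) / 2) • (e3 K A b * i13 K A (D (a ⊗ₜ[K] c))) := by
  unfold Jp
  rw [otimes1_eq, otimes1_eq, map_one, one_mul, map_mul, i13_r]

lemma Jp_inv3 (hD : LeibnizRules K A D) {a b x y : A} {al be : K} (hxy : x * y = 1)
    (hyx : y * x = 1) (h : Jp D a al b be x) : Jp D a al b be y := by
  rw [Jp_iff] at *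
  have h0 := DJac_mul3 hD a b x y
  rw [hxy, DJac_one3 hD] at h0
  have h1 := solve_inv (ly := e1 K A y) (by rw [← map_mul, hyx, map_one]) h0.symm
  have h2 := hD.1 a x y
  rw [hxy, D_one_right hD] at h2
  have h3 := solve_inv (ly := y ⊗ₜ[K] (1 : A)) (by simp [hyx, Algebra.TensorProduct.one_def]) h2.symm
  rw [h1, h, h3]
  simp only [mul_add, add_mul, smul_mul_assoc, mul_smul_comm, map_sub, map_mul, mul_sub, map_zero,
    mul_zero, i13_l, i13_r, mul_assoc, c21', c31']
  module

lemma Jp_inv2 (hD : LeibnizRules K A D) {a x y c : A} {al be : K} (hxy : x * y = 1)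
    (hyx : y * x = 1) (h : Jp D a al x be c) : Jp D a al y (-be) c := by
  rw [Jp_iff] at *
  have h0 := DJac_mul2 hD a x y c
  rw [hxy, DJac_one2 hD] at h0
  have h1 := solve_inv (ly := e3 K A y) (by rw [← map_mul, hyx, map_one]) h0.symm
  have hx2 : ∀ z, e2 K A x * (e2 K A y * z) = z := fun z => by
    rw [← mul_assoc, ← map_mul, hxy, map_one, one_mul]
  have hx3 : ∀ z, e3 K A y * (e3 K A x * z) = z := fun z => by
    rw [← mul_assoc, ← map_mul, hyx, map_one, one_mul]
  rw [h1, h]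
  simp only [mul_add, add_mul, smul_mul_assoc, mul_smul_comm, mul_assoc, c32', ci2, hx2, hx3]
  module

lemma Jp_inv1 (hD : LeibnizRules K A D) {x y b c : A} {al be : K} (hxy : x * y = 1)
    (hyx : y * x = 1) (hs : Sp D x al b be) (h : Jp D x al b be c) : Jp D y (-al) b be c := by
  rw [Jp_iff] at *
  have hs' := Sp_symm hs
  unfold Sp at hs'
  have h0 := DJac_mul1 hD x y b c
  rw [hxy, DJac_one1 hD, add_sub_assoc] at h0
  have h1 := solve_inv (ly := e2 K A y) (by rw [← map_mul, hyx, map_one]) h0.symm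
  have h2 := hD.2 y x c
  rw [hyx, D_one_left hD] at h2
  have h3 := solve_inv (ly := (1 : A) ⊗ₜ[K] x) (by simp [hxy, Algebra.TensorProduct.one_def]) h2.symm
  have hx1 : e1 K A x * e1 K A y = 1 := by rw [← map_mul, hxy, map_one]
  have hx2 : ∀ z, e2 K A y * (e2 K A x * z) = z := fun z => by
    rw [← mul_assoc, ← map_mul, hyx, map_one, one_mul]
  rw [h1, h, h3, hs']
  simp only [mul_add, add_mul, mul_sub, sub_mul, smul_mul_assoc, mul_smul_comm, map_sub,
    map_add, map_smul, map_mul, i23_t, map_zero, map_one, one_mul, mul_one,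
    mul_zero, i13_l, i13_r, mul_assoc, c32', hx1, hx2, zero_mul]
  module

end Inverse

end TripleTensor

section FreeGroupAlgebra

variable {K : Type*} [Field K] {X : Type*}

local notation "LL" => MonoidAlgebra K (FreeGroup X)

lemma gens_adjoin : Algebra.adjoin K (Set.range (Sum.elim
    (fun i : X => MonoidAlgebra.of K (FreeGroup X) (FreeGroup.of i))
    (fun i : X => MonoidAlgebra.of K (FreeGroup X) (FreeGroup.of i)⁻¹))) = ⊤ := by
  rw [eq_top_iff]
  rintro a -
  have hg : ∀ w : FreeGroup X, MonoidAlgebra.of K (FreeGroup X) w ∈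
      Algebra.adjoin K (Set.range (Sum.elim
    (fun i : X => MonoidAlgebra.of K (FreeGroup X) (FreeGroup.of i))
    (fun i : X => MonoidAlgebra.of K (FreeGroup X) (FreeGroup.of i)⁻¹))) := by
    intro w
    refine FreeGroup.induction_on w ?_ ?_ ?_ ?_
    · rw [map_one]; exact one_mem _
    · exact fun x => Algebra.subset_adjoin ⟨Sum.inl x, rfl⟩
    · exact fun x _ => Algebra.subset_adjoin ⟨Sum.inr x, rfl⟩
    · intro x y hx hy; rw [map_mul]; exact mul_mem hx hy
  induction a using MonoidAlgebra.induction_on with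
  | of g => exact hg g
  | add x y hx hy => exact add_mem hx hy
  | smul r x hx => exact Subalgebra.smul_mem _ hx r

variable {T : Type*} [Ring T] [Algebra K T]

lemma of_mul_inv (i : X) : MonoidAlgebra.of K (FreeGroup X) (FreeGroup.of i) *
    MonoidAlgebra.of K (FreeGroup X) (FreeGroup.of i)⁻¹ = 1 := by
  rw [← map_mul, mul_inv_cancel, map_one]
lemma of_inv_mul (i : X) : MonoidAlgebra.of K (FreeGroup X) (FreeGroup.of i)⁻¹ *
    MonoidAlgebra.of K (FreeGroup X) (FreeGroup.of i) = 1 := by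
  rw [← map_mul, inv_mul_cancel, map_one]

lemma exists_der (l r : MonoidAlgebra K (FreeGroup X) →ₐ[K] T) (t : X → T) :
    ∃ d : MonoidAlgebra K (FreeGroup X) →ₗ[K] T,
      (∀ a b, d (a * b) = l a * d b + d a * r b) ∧
      ∀ i, d (MonoidAlgebra.of K (FreeGroup X) (FreeGroup.of i)) = t i := by
  let g : X → LL := fun i => MonoidAlgebra.of K (FreeGroup X) (FreeGroup.of i)
  let g' : X → LL := fun i => MonoidAlgebra.of K (FreeGroup X) (FreeGroup.of i)⁻¹
  have hg : ∀ i, g i * g' i = 1 := of_mul_inv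
  have hg' : ∀ i, g' i * g i = 1 := of_inv_mul
  have hl : ∀ i, l (g i) * l (g' i) = 1 := fun i => by rw [← map_mul, hg, map_one]
  have hl' : ∀ i, l (g' i) * l (g i) = 1 := fun i => by rw [← map_mul, hg', map_one]
  have hr : ∀ i, r (g i) * r (g' i) = 1 := fun i => by rw [← map_mul, hg, map_one]
  have hr' : ∀ i, r (g' i) * r (g i) = 1 := fun i => by rw [← map_mul, hg', map_one]
  let U : X → (Matrix (Fin 2) (Fin 2) T)ˣ := fun i =>
    { val := !![l (g i), t i; 0, r (g i)]
      inv := !![l (g' i), - (l (g' i) * t i * r (g' i)); 0, r (g' i)]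
      val_inv := by
        simp only [Matrix.mul_fin_two, Matrix.one_fin_two, hl, hr, mul_neg, ← mul_assoc]
        simp
      inv_val := by
        simp only [Matrix.mul_fin_two, Matrix.one_fin_two, hl', hr', neg_mul, mul_assoc]
        simp }
  let F : LL →ₐ[K] Matrix (Fin 2) (Fin 2) T :=
    MonoidAlgebra.lift K _ _ ((Units.coeHom _).comp (FreeGroup.lift U))
  have hFg : ∀ i, F (g i) = !![l (g i), t i; 0, r (g i)] := by
    intro i; simp [F, g, U]
  have hFg' : ∀ i, F (g' i) = !![l (g' i), - (l (g' i) * t i * r (g' i)); 0, r (g' i)] := by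
    intro i; simp only [F, g', U, MonoidAlgebra.lift_of]; simp
  have key : ∀ a, F a 0 0 = l a ∧ F a 1 0 = 0 ∧ F a 1 1 = r a := by
    refine gen_ind gens_adjoin ?_ ?_ ?_ ?_ ?_
    · rintro (i | i)
      · change F (g i) 0 0 = l (g i) ∧ F (g i) 1 0 = 0 ∧ F (g i) 1 1 = r (g i)
        rw [hFg]; simp
      · change F (g' i) 0 0 = l (g' i) ∧ F (g' i) 1 0 = 0 ∧ F (g' i) 1 1 = r (g' i)
        rw [hFg']; simp
    · simp
    · rintro k a ⟨h1, h2, h3⟩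
      simp [h1, h2, h3]
    · rintro a b ⟨h1, h2, h3⟩ ⟨h1', h2', h3'⟩
      simp [h1, h2, h3, h1', h2', h3']
    · rintro a b ⟨h1, h2, h3⟩ ⟨h1', h2', h3'⟩
      simp [Matrix.mul_apply, h1, h2, h3, h1', h2', h3']
  refine ⟨Matrix.entryLinearMap K T 0 1 ∘ₗ F.toLinearMap, fun a b => ?_, fun i => ?_⟩
  · simp [Matrix.mul_apply, (key a).1, (key b).2.2]
  · change F (g i) 0 1 = t i
    rw [hFg]; simp

lemma der_unique (l r : MonoidAlgebra K (FreeGroup X) →ₐ[K] T)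
    {d d' : MonoidAlgebra K (FreeGroup X) →ₗ[K] T}
    (hd : ∀ a b, d (a * b) = l a * d b + d a * r b)
    (hd' : ∀ a b, d' (a * b) = l a * d' b + d' a * r b)
    (h : ∀ i, d (MonoidAlgebra.of K (FreeGroup X) (FreeGroup.of i)) =
      d' (MonoidAlgebra.of K (FreeGroup X) (FreeGroup.of i))) : d = d' := by
  have h1 : d 1 = 0 := by simpa using hd 1 1
  have h1' : d' 1 = 0 := by simpa using hd' 1 1
  refine LinearMap.ext fun a => ?_
  refine gen_ind gens_adjoin (p := fun a => d a = d' a) ?_ ?_ ?_ ?_ ?_ a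
  · rintro (i | i)
    · exact h i
    · simp only [Sum.elim_inr]
      have e := hd (MonoidAlgebra.of K (FreeGroup X) (FreeGroup.of i))
        (MonoidAlgebra.of K (FreeGroup X) (FreeGroup.of i)⁻¹)
      have e' := hd' (MonoidAlgebra.of K (FreeGroup X) (FreeGroup.of i))
        (MonoidAlgebra.of K (FreeGroup X) (FreeGroup.of i)⁻¹)
      rw [of_mul_inv, h1] at e
      rw [of_mul_inv, h1'] at e'
      have hl : l (MonoidAlgebra.of K (FreeGroup X) (FreeGroup.of i)⁻¹) *
          l (MonoidAlgebra.of K (FreeGroup X) (FreeGroup.of i)) = 1 := by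
        rw [← map_mul, of_inv_mul, map_one]
      rw [solve_inv hl e.symm, solve_inv hl e'.symm, h]
  · rw [h1, h1']
  · intro k a ha; rw [map_smul, map_smul, ha]
  · intro a b ha hb; rw [map_add, map_add, ha, hb]
  · intro a b ha hb; rw [hd, hd', ha, hb]

end FreeGroupAlgebra

section Transfer

variable {K : Type*} [Field K] {A : Type*} [Ring A] [Algebra K A]
  {B : Type*} [Ring B] [Algebra K B] (f : A →ₐ[K] B)

noncomputable def f2 : A ⊗[K] A →ₐ[K] B ⊗[K] B := Algebra.TensorProduct.map f f
noncomputable def f3 : (A ⊗[K] A) ⊗[K] A →ₐ[K] (B ⊗[K] B) ⊗[K] B :=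
  Algebra.TensorProduct.map (f2 f) f

lemma f2_t (a b : A) : f2 f (a ⊗ₜ[K] b) = f a ⊗ₜ f b := by simp [f2]
lemma f3_t (w : A ⊗[K] A) (b : A) : f3 f (w ⊗ₜ[K] b) = f2 f w ⊗ₜ f b := by simp [f3]

lemma f3_e1 (a : A) : f3 f (e1 K A a) = e1 K B (f a) := by
  simp only [e1_apply, f3_t, f2_t, map_one]
lemma f3_e2 (a : A) : f3 f (e2 K A a) = e2 K B (f a) := by
  simp only [e2_apply, f3_t, f2_t, map_one]
lemma f3_e3 (a : A) : f3 f (e3 K A a) = e3 K B (f a) := by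
  simp only [e3_apply, f3_t, map_one]
lemma f3_i12 (w : A ⊗[K] A) : f3 f (i12 K A w) = i12 K B (f2 f w) := by
  simp only [i12_apply, f3_t, map_one]
lemma f3_i13 (w : A ⊗[K] A) : f3 f (i13 K A w) = i13 K B (f2 f w) := by
  induction w with
  | zero => simp only [map_zero]
  | add x y hx hy => simp only [map_add, hx, hy]
  | tmul x y => simp only [i13_tmul, f3_t, f2_t, map_one]
lemma f3_i23 (w : A ⊗[K] A) : f3 f (i23 K A w) = i23 K B (f2 f w) := by
  induction w with
  | zero => simp only [map_zero]
  | add x y hx hy => simp only [map_add, hx, hy]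
  | tmul x y => simp only [i23_tmul, f3_t, f2_t, map_one]
lemma f2_flip (w : A ⊗[K] A) : f2 f (flipT K A w) = flipT K B (f2 f w) := by
  induction w with
  | zero => simp only [map_zero]
  | add x y hx hy => simp only [map_add, hx, hy]
  | tmul x y => simp only [flipT_tmul, f2_t]

variable {f} {D : A ⊗[K] A →ₗ[K] A ⊗[K] A} {E : B ⊗[K] B →ₗ[K] B ⊗[K] B}
  (hE : ∀ a b, E (f a ⊗ₜ[K] f b) = f2 f (D (a ⊗ₜ[K] b)))
include hE

lemma f3_dL (a : A) (w : A ⊗[K] A) : f3 f (dL K A D a w) = dL K B E (f a) (f2 f w) := by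
  induction w with
  | zero => simp only [map_zero]
  | add x y hx hy => simp only [map_add, hx, hy]
  | tmul x y => simp only [dL_t, map_mul, f3_i12, f3_e3, f2_t, hE]
lemma f3_dR (a : A) (w : A ⊗[K] A) : f3 f (dR K A D a w) = dR K B E (f a) (f2 f w) := by
  induction w with
  | zero => simp only [map_zero]
  | add x y hx hy => simp only [map_add, hx, hy]
  | tmul x y => simp only [dR_t, map_mul, f3_i23, f3_e1, f2_t, hE]
lemma f3_dLfst (a : A) (w : A ⊗[K] A) :
    f3 f (dLfst K A D a w) = dLfst K B E (f a) (f2 f w) := by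
  induction w with
  | zero => simp only [map_zero]
  | add x y hx hy => simp only [map_add, hx, hy]
  | tmul x y => simp only [dLfst_t, map_mul, f3_i13, f3_e2, f2_t, hE]
lemma f3_DJac (a b c : A) : f3 f (DJac K A D a b c) = DJac K B E (f a) (f b) (f c) := by
  simp only [DJac, map_sub, f3_dL hE, f3_dR hE, f3_dLfst hE, hE]

lemma Sp_transfer {a b : A} {al be : K} (h : Sp D a al b be) : Sp E (f a) al (f b) be := by
  unfold Sp SS at *
  have := congrArg (f2 f) h
  simpa only [map_add, map_sub, map_smul, f2_t, f2_flip, map_mul, map_one, ← hE] using this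

lemma Jp_transfer {a b c : A} {al be : K} (h : Jp D a al b be c) :
    Jp E (f a) al (f b) be (f c) := by
  rw [Jp_iff] at *
  have := congrArg (f3 f) h
  simpa only [map_add, map_smul, map_mul, f3_e2, f3_e3, f3_i13, f3_DJac hE, ← hE] using this

omit hE in
lemma hE_of_gens {ι : Type*} {u : ι → A} (hgen : Algebra.adjoin K (Set.range u) = ⊤)
    (hD : LeibnizRules K A D) (hE : LeibnizRules K B E)
    (h : ∀ i j, E (f (u i) ⊗ₜ[K] f (u j)) = f2 f (D (u i ⊗ₜ[K] u j))) (a b : A) :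
    E (f a ⊗ₜ[K] f b) = f2 f (D (a ⊗ₜ[K] b)) := by
  refine gen_ind hgen (p := fun a => E (f a ⊗ₜ[K] f b) = f2 f (D (a ⊗ₜ[K] b))) ?_ ?_ ?_ ?_ ?_ a
  · intro i
    refine gen_ind hgen (p := fun b => E (f (u i) ⊗ₜ[K] f b) = f2 f (D (u i ⊗ₜ[K] b)))
      ?_ ?_ ?_ ?_ ?_ b
    · exact h i
    · simp only [map_one, D_one_right hD, D_one_right hE, map_zero]
    · intro k x hx; simp only [map_smul, tmul_smul, hx]
    · intro x y hx hy; simp only [map_add, tmul_add, hx, hy]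
    · intro x y hx hy; simp only [map_mul, hD.1, hE.1, map_add, f2_t, map_one, hx, hy]
  · simp only [map_one, D_one_left hD, D_one_left hE, map_zero]
  · intro k x hx; simp only [map_smul, ← smul_tmul', hx]
  · intro x y hx hy; simp only [map_add, add_tmul, hx, hy]
  · intro x y hx hy; simp only [map_mul, hD.2, hE.2, map_add, f2_t, map_one, hx, hy]

end Transfer

section Existence

variable {K : Type*} [Field K] {X : Type*}

local notation "LL" => MonoidAlgebra K (FreeGroup X)

lemma exists_bracket (x : X → X → LL ⊗[K] LL) :
    ∃ E : LL ⊗[K] LL →ₗ[K] LL ⊗[K] LL, LeibnizRules K LL E ∧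
      ∀ i j, E (MonoidAlgebra.of K (FreeGroup X) (FreeGroup.of i) ⊗ₜ[K]
        MonoidAlgebra.of K (FreeGroup X) (FreeGroup.of j)) = x i j := by
  let l : LL →ₐ[K] LL ⊗[K] LL := Algebra.TensorProduct.includeLeft
  let r : LL →ₐ[K] LL ⊗[K] LL := Algebra.TensorProduct.includeRight
  have hl : ∀ a, l a = a ⊗ₜ[K] 1 := fun a => rfl
  have hr : ∀ a, r a = 1 ⊗ₜ[K] a := fun a => rfl
  have hlr : ∀ a b, l a * r b = r b * l a := fun a b => tcomm' a b
  choose de hde hdeg using fun i => exists_der l r (x i)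
  choose F hF hFg using fun c => exists_der r l (fun i => de i c)
  have hadd : ∀ c c', F (c + c') = F c + F c' := by
    intro c c'
    refine der_unique r l (hF _) ?_ ?_
    · intro a b
      simp only [LinearMap.add_apply, hF, mul_add, add_mul]; abel
    · intro i
      simp only [LinearMap.add_apply, hFg, map_add]
  have hsmul : ∀ (k : K) c, F (k • c) = k • F c := by
    intro k c
    refine der_unique r l (hF _) ?_ ?_
    · intro a b
      simp only [LinearMap.smul_apply, hF, smul_add, mul_smul_comm, smul_mul_assoc]
    · intro i
      simp only [LinearMap.smul_apply, hFg, map_smul]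
  have hmul : ∀ c c', F (c * c') =
      LinearMap.mulLeft K (l c) ∘ₗ F c' + LinearMap.mulRight K (r c') ∘ₗ F c := by
    intro c c'
    refine der_unique r l (hF _) ?_ ?_
    · intro a b
      simp only [LinearMap.add_apply, LinearMap.comp_apply, LinearMap.mulLeft_apply,
        LinearMap.mulRight_apply, hF, mul_add, add_mul]
      rw [← mul_assoc (l c) (r a), hlr, mul_assoc (F c a), hlr]
      simp only [mul_assoc]
      abel
    · intro i
      simp only [LinearMap.add_apply, LinearMap.comp_apply, LinearMap.mulLeft_apply,
        LinearMap.mulRight_apply, hFg, hde]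
  let G : LL →ₗ[K] LL →ₗ[K] LL ⊗[K] LL :=
    { toFun := F
      map_add' := hadd
      map_smul' := hsmul }
  have hG : ∀ a b, TensorProduct.lift G.flip (a ⊗ₜ[K] b) = F b a := fun a b => by
    rw [TensorProduct.lift.tmul]; rfl
  refine ⟨TensorProduct.lift G.flip, ⟨fun a b c => ?_, fun a b c => ?_⟩, fun i j => ?_⟩
  · simp only [hG, hmul]; rfl
  · simp only [hG, hF]; rfl
  · simp only [hG, hFg, hdeg]

lemma bracket_unique {E E' : LL ⊗[K] LL →ₗ[K] LL ⊗[K] LL} (hE : LeibnizRules K LL E)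
    (hE' : LeibnizRules K LL E')
    (h : ∀ i j, E (MonoidAlgebra.of K (FreeGroup X) (FreeGroup.of i) ⊗ₜ[K]
        MonoidAlgebra.of K (FreeGroup X) (FreeGroup.of j)) =
        E' (MonoidAlgebra.of K (FreeGroup X) (FreeGroup.of i) ⊗ₜ[K]
        MonoidAlgebra.of K (FreeGroup X) (FreeGroup.of j))) : E = E' := by
  let l : LL →ₐ[K] LL ⊗[K] LL := Algebra.TensorProduct.includeLeft
  let r : LL →ₐ[K] LL ⊗[K] LL := Algebra.TensorProduct.includeRight
  have h1 : ∀ i, E ∘ₗ TensorProduct.mk K LL LL (MonoidAlgebra.of K (FreeGroup X) (FreeGroup.of i)) =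
      E' ∘ₗ TensorProduct.mk K LL LL (MonoidAlgebra.of K (FreeGroup X) (FreeGroup.of i)) := by
    intro i
    refine der_unique l r (fun a b => hE.1 _ a b) (fun a b => hE'.1 _ a b) (fun j => h i j)
  have h2 : ∀ c, E ∘ₗ (TensorProduct.mk K LL LL).flip c =
      E' ∘ₗ (TensorProduct.mk K LL LL).flip c := by
    intro c
    refine der_unique r l (fun a b => hE.2 a b c) (fun a b => hE'.2 a b c)
      (fun j => LinearMap.congr_fun (h1 j) c)
  exact TensorProduct.ext' fun a b => LinearMap.congr_fun (h2 b) a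

lemma mixed_of_gens {E : LL ⊗[K] LL →ₗ[K] LL ⊗[K] LL} (hE : LeibnizRules K LL E) (lam : X → K)
    (hS : ∀ i j, Sp E (MonoidAlgebra.of K (FreeGroup X) (FreeGroup.of i)) (lam i)
      (MonoidAlgebra.of K (FreeGroup X) (FreeGroup.of j)) (lam j))
    (hJ : ∀ i j k, Jp E (MonoidAlgebra.of K (FreeGroup X) (FreeGroup.of i)) (lam i)
      (MonoidAlgebra.of K (FreeGroup X) (FreeGroup.of j)) (lam j)
      (MonoidAlgebra.of K (FreeGroup X) (FreeGroup.of k))) :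
    IsMixedDoublePoisson K LL
      (Sum.elim (fun i : X => MonoidAlgebra.of K (FreeGroup X) (FreeGroup.of i))
        (fun i : X => MonoidAlgebra.of K (FreeGroup X) (FreeGroup.of i)⁻¹))
      (Sum.elim lam (fun i => - lam i)) E := by
  have hS1 : ∀ (i : X ⊕ X) (j : X), Sp E ((Sum.elim
        (fun i : X => MonoidAlgebra.of K (FreeGroup X) (FreeGroup.of i))
        (fun i : X => MonoidAlgebra.of K (FreeGroup X) (FreeGroup.of i)⁻¹)) i)
      (Sum.elim lam (fun i => - lam i) i)
      (MonoidAlgebra.of K (FreeGroup X) (FreeGroup.of j)) (lam j) := by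
    rintro (i | i) j
    · exact hS i j
    · exact Sp_inv hE (of_mul_inv i) (of_inv_mul i) (hS i j)
  have hS2 : ∀ (i j : X ⊕ X), Sp E ((Sum.elim
        (fun i : X => MonoidAlgebra.of K (FreeGroup X) (FreeGroup.of i))
        (fun i : X => MonoidAlgebra.of K (FreeGroup X) (FreeGroup.of i)⁻¹)) i)
      (Sum.elim lam (fun i => - lam i) i)
      ((Sum.elim
        (fun i : X => MonoidAlgebra.of K (FreeGroup X) (FreeGroup.of i))
        (fun i : X => MonoidAlgebra.of K (FreeGroup X) (FreeGroup.of i)⁻¹)) j)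
      (Sum.elim lam (fun i => - lam i) j) := by
    rintro i (j | j)
    · exact hS1 i j
    · exact Sp_symm (Sp_inv hE (of_mul_inv j) (of_inv_mul j) (Sp_symm (hS1 i j)))
  have hJ1 : ∀ (i : X ⊕ X) (j k : X), Jp E ((Sum.elim
        (fun i : X => MonoidAlgebra.of K (FreeGroup X) (FreeGroup.of i))
        (fun i : X => MonoidAlgebra.of K (FreeGroup X) (FreeGroup.of i)⁻¹)) i)
      (Sum.elim lam (fun i => - lam i) i)
      (MonoidAlgebra.of K (FreeGroup X) (FreeGroup.of j)) (lam j)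
      (MonoidAlgebra.of K (FreeGroup X) (FreeGroup.of k)) := by
    rintro (i | i) j k
    · exact hJ i j k
    · exact Jp_inv1 hE (of_mul_inv i) (of_inv_mul i) (hS i j) (hJ i j k)
  refine ⟨⟨hE, hS2⟩, ?_⟩
  intro i j k
  change Jp E _ _ _ _ _
  have hJ2 : ∀ k : X, Jp E ((Sum.elim
        (fun i : X => MonoidAlgebra.of K (FreeGroup X) (FreeGroup.of i))
        (fun i : X => MonoidAlgebra.of K (FreeGroup X) (FreeGroup.of i)⁻¹)) i)
      (Sum.elim lam (fun i => - lam i) i)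
      ((Sum.elim
        (fun i : X => MonoidAlgebra.of K (FreeGroup X) (FreeGroup.of i))
        (fun i : X => MonoidAlgebra.of K (FreeGroup X) (FreeGroup.of i)⁻¹)) j)
      (Sum.elim lam (fun i => - lam i) j)
      (MonoidAlgebra.of K (FreeGroup X) (FreeGroup.of k)) := by
    intro k
    rcases j with j | j
    · exact hJ1 i j k
    · exact Jp_inv2 hE (of_mul_inv j) (of_inv_mul j) (hJ1 i j k)
  rcases k with k | k
  · exact hJ2 k
  · exact Jp_inv3 hE (of_mul_inv k) (of_inv_mul k) (hJ2 k)

lemma exists_P (lam : X → K) : ∃ P : LL →ₗ[K] LL ⊗[K] LL, InnerDer P ∧ ∀ i : X ⊕ X,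
    P (Sum.elim (fun i : X => MonoidAlgebra.of K (FreeGroup X) (FreeGroup.of i))
        (fun i : X => MonoidAlgebra.of K (FreeGroup X) (FreeGroup.of i)⁻¹) i) =
      (Sum.elim lam (fun i => - lam i) i / 2) •
      (Sum.elim (fun i : X => MonoidAlgebra.of K (FreeGroup X) (FreeGroup.of i))
        (fun i : X => MonoidAlgebra.of K (FreeGroup X) (FreeGroup.of i)⁻¹) i ⊗ₜ[K] 1 +
       1 ⊗ₜ[K] Sum.elim (fun i : X => MonoidAlgebra.of K (FreeGroup X) (FreeGroup.of i))
        (fun i : X => MonoidAlgebra.of K (FreeGroup X) (FreeGroup.of i)⁻¹) i) := by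
  obtain ⟨P, hP, hPg⟩ := exists_der (T := LL ⊗[K] LL) Algebra.TensorProduct.includeRight
    Algebra.TensorProduct.includeLeft (fun i : X => (lam i / 2) •
      (MonoidAlgebra.of K (FreeGroup X) (FreeGroup.of i) ⊗ₜ[K] (1 : LL) +
       (1 : LL) ⊗ₜ[K] MonoidAlgebra.of K (FreeGroup X) (FreeGroup.of i)))
  have hP' : InnerDer P := hP
  refine ⟨P, hP', ?_⟩
  rintro (i | i)
  · exact hPg i
  · simp only [Sum.elim_inr]
    have hg := of_mul_inv (K := K) i
    have hg' := of_inv_mul (K := K) i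
    have hPi := hPg i
    generalize MonoidAlgebra.of K (FreeGroup X) (FreeGroup.of i) = g at *
    generalize MonoidAlgebra.of K (FreeGroup X) (FreeGroup.of i)⁻¹ = g' at *
    have h0 := hP' g g'
    rw [hg, hP'.one] at h0
    rw [solve_inv (ly := (1 : LL) ⊗ₜ[K] g') (by simp [hg', Algebra.TensorProduct.one_def]) h0.symm,
      hPi]
    simp only [mul_add, add_mul, smul_mul_assoc, mul_smul_comm,
      Algebra.TensorProduct.tmul_mul_tmul, one_mul, mul_one, hg, hg']
    module

end Existence

theorem stmt10 {K : Type*} [Field K] [IsAlgClosed K] [CharZero K]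
    {d : ℕ} (hd : 1 ≤ d) (lam : Fin d → K)
    (D : FreeAlgebra K (Fin d) ⊗[K] FreeAlgebra K (Fin d) →ₗ[K]
         FreeAlgebra K (Fin d) ⊗[K] FreeAlgebra K (Fin d))
    (hD : IsMixedDoublePoisson K (FreeAlgebra K (Fin d)) (FreeAlgebra.ι K) lam D) :
    (∃! DL : MonoidAlgebra K (FreeGroup (Fin d)) ⊗[K] MonoidAlgebra K (FreeGroup (Fin d)) →ₗ[K]
             MonoidAlgebra K (FreeGroup (Fin d)) ⊗[K] MonoidAlgebra K (FreeGroup (Fin d)),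
        LeibnizRules K (MonoidAlgebra K (FreeGroup (Fin d))) DL ∧
        ∀ i j : Fin d,
          DL (MonoidAlgebra.of K (FreeGroup (Fin d)) (FreeGroup.of i) ⊗ₜ[K]
              MonoidAlgebra.of K (FreeGroup (Fin d)) (FreeGroup.of j)) =
            TensorProduct.map (laurentPhi K d).toLinearMap (laurentPhi K d).toLinearMap
              (D (FreeAlgebra.ι K i ⊗ₜ[K] FreeAlgebra.ι K j))) ∧
    (∀ DL : MonoidAlgebra K (FreeGroup (Fin d)) ⊗[K] MonoidAlgebra K (FreeGroup (Fin d)) →ₗ[K]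
            MonoidAlgebra K (FreeGroup (Fin d)) ⊗[K] MonoidAlgebra K (FreeGroup (Fin d)),
        (LeibnizRules K (MonoidAlgebra K (FreeGroup (Fin d))) DL ∧
          ∀ i j : Fin d,
            DL (MonoidAlgebra.of K (FreeGroup (Fin d)) (FreeGroup.of i) ⊗ₜ[K]
                MonoidAlgebra.of K (FreeGroup (Fin d)) (FreeGroup.of j)) =
              TensorProduct.map (laurentPhi K d).toLinearMap (laurentPhi K d).toLinearMap
                (D (FreeAlgebra.ι K i ⊗ₜ[K] FreeAlgebra.ι K j))) →
        (IsMixedDoublePoisson K (MonoidAlgebra K (FreeGroup (Fin d)))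
            (Sum.elim
              (fun i : Fin d => MonoidAlgebra.of K (FreeGroup (Fin d)) (FreeGroup.of i))
              (fun i : Fin d => MonoidAlgebra.of K (FreeGroup (Fin d)) (FreeGroup.of i)⁻¹))
            (Sum.elim lam (fun i : Fin d => - lam i)) DL ∧
          IsModifiedDoublePoisson K (MonoidAlgebra K (FreeGroup (Fin d))) DL)) := by
  have hphi : ∀ i, laurentPhi K d (FreeAlgebra.ι K i) =
      MonoidAlgebra.of K (FreeGroup (Fin d)) (FreeGroup.of i) := fun i => by
    simp [laurentPhi]
  refine ⟨?_, ?_⟩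
  · obtain ⟨E, hE, hEg⟩ := exists_bracket (K := K) (fun i j : Fin d =>
      TensorProduct.map (laurentPhi K d).toLinearMap (laurentPhi K d).toLinearMap
              (D (FreeAlgebra.ι K i ⊗ₜ[K] FreeAlgebra.ι K j)))
    refine ⟨E, ⟨hE, hEg⟩, ?_⟩
    rintro E' ⟨hE', hEg'⟩
    exact bracket_unique hE' hE fun i j => (hEg' i j).trans (hEg i j).symm
  · rintro E ⟨hE, hEg⟩
    have hgen : Algebra.adjoin K (Set.range (FreeAlgebra.ι K : Fin d → _)) = ⊤ :=
      FreeAlgebra.adjoin_range_ι K (Fin d)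
    have key := hE_of_gens (f := laurentPhi K d) hgen hD.1.1 hE (fun i j => by
      rw [hphi, hphi]; exact hEg i j)
    have hM := mixed_of_gens hE lam
      (fun i j => by
        rw [← hphi, ← hphi]; exact Sp_transfer key (hD.1.2 i j))
      (fun i j k => by
        rw [← hphi, ← hphi, ← hphi]; exact Jp_transfer key (hD.2 i j k))
    refine ⟨hM, ?_⟩
    obtain ⟨P, hP, hPu⟩ := exists_P (X := Fin d) lam
    exact modified_of_mixed gens_adjoin hM hP hPu
end
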